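/- arXiv:0810.0853 — 3 statements merged into one kernel-verified Lean document; each statement's English description precedes it below -/
import Mathlib

section
/- Let F be an algebraically closed field, V an F-vector space with dim(V) ≥ 3, and G ≤ GL(V) a subgroup such that Sym^k(V) is irreducible over G for some k ≥ 2. Then char(F) = 0 or char(F) > k. In particular, if 0 < char(F) = ℓ ≤ k and dim(V) ≥ 3, then Sym^k(V) is reducible already over SL(V): writing k = a₀ + a₁ℓ + … + a_sℓ^s in base ℓ with s ≥ 1, one has dim(Sym^k(V)) > dim(Sym^{a₀}(V)) · dim(Sym^{a₁}(V)) · … · dim(Sym^{a_s}(V)), while by Steinberg's tensor product theorem Sym^k(V) has a quotient isomorphic to the tensor product of the appropriately Frobenius-twisted modules Sym^{a_i}(V)^{(ℓ^i)}. -/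
open scoped TensorProduct
open Matrix

noncomputable section

namespace GuralnickTiep

variable {F : Type*} [Field F] {d : ℕ}

/-- The substitution action of a matrix `g` on polynomials, extending the linear action of
`g` on the span of the variables: `X i ↦ ∑ j, g j i • X j`. -/
def matSubst (g : Matrix (Fin d) (Fin d) F) :
    MvPolynomial (Fin d) F →ₐ[F] MvPolynomial (Fin d) F :=
  MvPolynomial.aeval fun i => ∑ j, MvPolynomial.C (g j i) * MvPolynomial.X j

/-- The `k`-th symmetric power of `F^d`, realized as the space of homogeneous polynomials
of degree `k` in `d` variables. -/
abbrev symPow (F : Type*) [Field F] (d k : ℕ) : Submodule F (MvPolynomial (Fin d) F) :=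
  MvPolynomial.homogeneousSubmodule (Fin d) F k

def SymInvariant (G : Subgroup (GL (Fin d) F)) (W : Submodule F (MvPolynomial (Fin d) F)) : Prop :=
  ∀ g ∈ G, ∀ p ∈ W, matSubst ((g : GL (Fin d) F) : Matrix (Fin d) (Fin d) F) p ∈ W

/-- `Sym^k(V)` is irreducible as a module over the subgroup `G ≤ GL(V)`. -/
def SymIrreducible (G : Subgroup (GL (Fin d) F)) (k : ℕ) : Prop :=
  symPow F d k ≠ ⊥ ∧
    ∀ W : Submodule F (MvPolynomial (Fin d) F),
      W ≤ symPow F d k → SymInvariant G W → W = ⊥ ∨ W = symPow F d k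

/-- action of `g` on the exterior algebra of `F^d`. -/
def extSubst (g : Matrix (Fin d) (Fin d) F) :
    ExteriorAlgebra F (Fin d → F) →ₐ[F] ExteriorAlgebra F (Fin d → F) :=
  ExteriorAlgebra.map g.mulVecLin

def ExtInvariant (G : Subgroup (GL (Fin d) F))
    (W : Submodule F (ExteriorAlgebra F (Fin d → F))) : Prop :=
  ∀ g ∈ G, ∀ v ∈ W, extSubst ((g : GL (Fin d) F) : Matrix (Fin d) (Fin d) F) v ∈ W

/-- `⋀^k(V)` is irreducible as a module over the subgroup `G ≤ GL(V)`. -/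
def ExtIrreducible (G : Subgroup (GL (Fin d) F)) (k : ℕ) : Prop :=
  (⋀[F]^k (Fin d → F)) ≠ ⊥ ∧
    ∀ W : Submodule F (ExteriorAlgebra F (Fin d → F)),
      W ≤ ⋀[F]^k (Fin d → F) → ExtInvariant G W → W = ⊥ ∨ W = ⋀[F]^k (Fin d → F)

/-- coordinates of an element of `GL_d` together with the coordinates of its inverse;
polynomial conditions on these cut out the Zariski closed subsets of `GL_d`. -/
def glCoords (g : GL (Fin d) F) : (Fin d × Fin d) ⊕ (Fin d × Fin d) → F :=
  Sum.elim (fun q => (g : Matrix (Fin d) (Fin d) F) q.1 q.2)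
    (fun q => ((g⁻¹ : GL (Fin d) F) : Matrix (Fin d) (Fin d) F) q.1 q.2)

/-- A subset of `GL_d(F)` is Zariski closed if it is the common zero locus of a family of
polynomials in the matrix entries and the entries of the inverse matrix. -/
def ZariskiClosed (S : Set (GL (Fin d) F)) : Prop :=
  ∃ T : Set (MvPolynomial ((Fin d × Fin d) ⊕ (Fin d × Fin d)) F),
    S = {g | ∀ p ∈ T, MvPolynomial.eval (glCoords g) p = 0}

/-- `SL(V)` as a subgroup of `GL(V)`. -/
def SLsub (F : Type*) [Field F] (d : ℕ) : Subgroup (GL (Fin d) F) where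
  carrier := {g | ((g : GL (Fin d) F) : Matrix (Fin d) (Fin d) F).det = 1}
  one_mem' := by simp
  mul_mem' := by
    intro a b ha hb
    simp only [Set.mem_setOf_eq, Units.val_mul, Matrix.det_mul] at *
    rw [ha, hb, one_mul]
  inv_mem' := by
    intro a ha
    simp only [Set.mem_setOf_eq] at *
    have h : ((a : Matrix (Fin d) (Fin d) F) * ((a⁻¹ : GL (Fin d) F) : Matrix (Fin d) (Fin d) F)).det = 1 := by
      rw [← Units.val_mul, mul_inv_cancel, Units.val_one, Matrix.det_one]
    rw [Matrix.det_mul, ha, one_mul] at h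
    exact h

/-- The isometry group of the (possibly `σ`-sesquilinear) form given by the Gram matrix `J`,
as a subgroup of `GL_d`. -/
def isomGroup {R : Type*} [CommRing R] (σ : R →+* R) {d : ℕ}
    (J : Matrix (Fin d) (Fin d) R) : Subgroup (GL (Fin d) R) where
  carrier := {g | (((g : GL (Fin d) R) : Matrix (Fin d) (Fin d) R).map σ)ᵀ * J *
      ((g : GL (Fin d) R) : Matrix (Fin d) (Fin d) R) = J}
  one_mem' := by
    simp only [Set.mem_setOf_eq, Units.val_one,
      Matrix.map_one σ (map_zero σ) (map_one σ), Matrix.transpose_one, one_mul, mul_one]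
  mul_mem' := by
    intro a b ha hb
    simp only [Set.mem_setOf_eq, Units.val_mul] at *
    rw [Matrix.map_mul, Matrix.transpose_mul]
    calc ((b : Matrix (Fin d) (Fin d) R).map σ)ᵀ * ((a : Matrix (Fin d) (Fin d) R).map σ)ᵀ * J *
          ((a : Matrix (Fin d) (Fin d) R) * (b : Matrix (Fin d) (Fin d) R))
        = ((b : Matrix (Fin d) (Fin d) R).map σ)ᵀ *
            ((((a : Matrix (Fin d) (Fin d) R).map σ)ᵀ * J * (a : Matrix (Fin d) (Fin d) R)) *
            (b : Matrix (Fin d) (Fin d) R)) := by noncomm_ring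
      _ = J := by rw [ha, ← mul_assoc, hb]
  inv_mem' := by
    intro a ha
    simp only [Set.mem_setOf_eq] at *
    calc (((a⁻¹ : GL (Fin d) R) : Matrix (Fin d) (Fin d) R).map σ)ᵀ * J *
          ((a⁻¹ : GL (Fin d) R) : Matrix (Fin d) (Fin d) R)
        = (((a⁻¹ : GL (Fin d) R) : Matrix (Fin d) (Fin d) R).map σ)ᵀ *
            (((a : Matrix (Fin d) (Fin d) R).map σ)ᵀ * J * (a : Matrix (Fin d) (Fin d) R)) *
            ((a⁻¹ : GL (Fin d) R) : Matrix (Fin d) (Fin d) R) := by rw [ha]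
      _ = (((a : Matrix (Fin d) (Fin d) R) * ((a⁻¹ : GL (Fin d) R) : Matrix (Fin d) (Fin d) R)).map σ)ᵀ
            * J * ((a : Matrix (Fin d) (Fin d) R) * ((a⁻¹ : GL (Fin d) R) : Matrix (Fin d) (Fin d) R)) := by
          rw [Matrix.map_mul, Matrix.transpose_mul]; noncomm_ring
      _ = J := by
          rw [← Units.val_mul, mul_inv_cancel, Units.val_one,
            Matrix.map_one σ (map_zero σ) (map_one σ), Matrix.transpose_one, one_mul, mul_one]

/-- a nondegenerate alternating bilinear form (Gram matrix). -/
def IsAltMat {R : Type*} [CommRing R] {d : ℕ} (J : Matrix (Fin d) (Fin d) R) : Prop :=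
  IsUnit J ∧ Jᵀ = -J ∧ ∀ i, J i i = 0

/-- a nondegenerate symmetric bilinear form (Gram matrix). -/
def IsSymMat {R : Type*} [CommRing R] {d : ℕ} (J : Matrix (Fin d) (Fin d) R) : Prop :=
  IsUnit J ∧ Jᵀ = J

/-- the symplectic group of an alternating form `J`. -/
abbrev SpGroup {R : Type*} [CommRing R] {d : ℕ} (J : Matrix (Fin d) (Fin d) R) :
    Subgroup (GL (Fin d) R) := isomGroup (RingHom.id R) J

/-- the full orthogonal group of a symmetric form `J`. -/
abbrev GOGroup {R : Type*} [CommRing R] {d : ℕ} (J : Matrix (Fin d) (Fin d) R) :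
    Subgroup (GL (Fin d) R) := isomGroup (RingHom.id R) J

/-- `H` is a normal subgroup of `G` (so in particular `G` normalizes `H`). -/
def NormalIn {Γ : Type*} [Group Γ] (H G : Subgroup Γ) : Prop :=
  H ≤ G ∧ ∀ g ∈ G, ∀ h ∈ H, g * h * g⁻¹ ∈ H


/-- The exponent vector `(ℓ m - 1, 1, a, 0, …)` has degree `a + ℓ m`, but its residues modulo `ℓ`
add up to `a + ℓ`, so it is not of the form `β + ℓ γ` with `β` of degree `a`. -/
lemma exists_degree_eq_forall_add_nsmul_ne {d ℓ a m : ℕ} (hd : 3 ≤ d) (hℓ : 2 ≤ ℓ) (ha : a < ℓ)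
    (hm : 0 < m) :
    ∃ α : Fin d →₀ ℕ, α.degree = a + ℓ * m ∧
      ∀ β γ : Fin d →₀ ℕ, β.degree = a → β + ℓ • γ ≠ α := by
  obtain ⟨n, rfl⟩ := Nat.exists_eq_add_of_le' hd
  have hpos : ℓ ≤ ℓ * m := Nat.le_mul_of_pos_right ℓ hm
  refine ⟨Finsupp.equivFunOnFinite.symm (Fin.cons (ℓ * m - 1) (Fin.cons 1 (Fin.cons a 0))), ?_, ?_⟩
  · simp [Finsupp.degree_eq_sum, Fin.sum_univ_succ]
    omega
  · intro β γ hβ h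
    have h0 := DFunLike.congr_fun h 0
    have h1 := DFunLike.congr_fun h 1
    have h2 := DFunLike.congr_fun h 2
    rw [Finsupp.degree_eq_sum, Fin.sum_univ_succ, Fin.sum_univ_succ, Fin.sum_univ_succ] at hβ
    change β 0 + (β 1 + (β 2 + _)) = a at hβ
    change β 0 + ℓ * γ 0 = ℓ * m - 1 at h0
    change β 1 + ℓ * γ 1 = 1 at h1
    change β 2 + ℓ * γ 2 = a at h2
    have h0' : ℓ ≤ β 0 + 1 := by
      have hlt : γ 0 < m := by
        by_contra! hge
        have := Nat.mul_le_mul_left ℓ hge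
        omega
      have := Nat.mul_le_mul_left ℓ (Nat.succ_le_of_lt hlt)
      rw [Nat.mul_succ] at this
      omega
    have h1' : γ 1 = 0 := by
      by_contra hne
      have := Nat.le_mul_of_pos_right ℓ (Nat.pos_of_ne_zero hne)
      omega
    have h2' : γ 2 = 0 := by
      by_contra hne
      have := Nat.le_mul_of_pos_right ℓ (Nat.pos_of_ne_zero hne)
      omega
    rw [h1'] at h1
    rw [h2'] at h2
    omega

lemma add_nsmul_injOn {d ℓ a : ℕ} (ha : a < ℓ) :
    Set.InjOn (fun x : (Fin d →₀ ℕ) × (Fin d →₀ ℕ) => x.1 + ℓ • x.2) {x | x.1.degree = a} := by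
  rintro ⟨β, γ⟩ hβ ⟨β', γ'⟩ hβ' h
  have key : ∀ i, β i = β' i ∧ γ i = γ' i := by
    intro i
    have hi : β i + ℓ * γ i = β' i + ℓ * γ' i := DFunLike.congr_fun h i
    have hlt : β i < ℓ := (Finsupp.le_degree i β).trans_lt (hβ.trans_lt ha)
    have hlt' : β' i < ℓ := (Finsupp.le_degree i β').trans_lt (hβ'.trans_lt ha)
    have hmod := congrArg (· % ℓ) hi
    simp only [Nat.add_mul_mod_self_left, Nat.mod_eq_of_lt hlt, Nat.mod_eq_of_lt hlt'] at hmod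
    refine ⟨hmod, ?_⟩
    rw [hmod] at hi
    exact Nat.eq_of_mul_eq_mul_left (by omega) (Nat.add_left_cancel hi)
  exact Prod.ext (Finsupp.ext fun i => (key i).1) (Finsupp.ext fun i => (key i).2)

lemma card_finsuppAntidiag_univ_fin (d n : ℕ) :
    (Finset.finsuppAntidiag (Finset.univ : Finset (Fin d)) n).card = (n + d - 1).choose n := by
  rw [Finset.card_finsuppAntidiag_nat_eq_choose, Finset.card_univ, Fintype.card_fin, add_comm d]

lemma mem_finsuppAntidiag_univ_iff {d n : ℕ} {α : Fin d →₀ ℕ} :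
    α ∈ Finset.finsuppAntidiag (Finset.univ : Finset (Fin d)) n ↔ α.degree = n := by
  simp [Finset.mem_finsuppAntidiag, Finsupp.degree_eq_sum]

lemma choose_mul_choose_lt {d ℓ a m : ℕ} (hd : 3 ≤ d) (hℓ : 2 ≤ ℓ) (ha : a < ℓ) (hm : 0 < m) :
    (a + d - 1).choose a * (m + d - 1).choose m < (a + ℓ * m + d - 1).choose (a + ℓ * m) := by
  simp only [← card_finsuppAntidiag_univ_fin]
  obtain ⟨α, hα, hne⟩ := exists_degree_eq_forall_add_nsmul_ne hd hℓ ha hm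
  rw [← Finset.card_product, ← Finset.card_image_of_injOn
    ((add_nsmul_injOn (d := d) ha).mono fun x hx => by
      simpa [mem_finsuppAntidiag_univ_iff] using
        mem_finsuppAntidiag_univ_iff.1 (Finset.mem_product.1 hx).1)]
  refine Finset.card_lt_card <| (Finset.ssubset_iff_of_subset ?_).2
    ⟨α, mem_finsuppAntidiag_univ_iff.2 hα, ?_⟩
  · intro x hx
    obtain ⟨⟨β, γ⟩, h, rfl⟩ := Finset.mem_image.1 hx
    rw [Finset.mem_product, mem_finsuppAntidiag_univ_iff, mem_finsuppAntidiag_univ_iff] at h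
    rw [mem_finsuppAntidiag_univ_iff, map_add, map_nsmul, h.1, h.2, smul_eq_mul]
  · intro hx
    obtain ⟨⟨β, γ⟩, h, hαeq⟩ := Finset.mem_image.1 hx
    exact hne β γ (mem_finsuppAntidiag_univ_iff.1 (Finset.mem_product.1 h).1) hαeq

lemma prod_digits_choose_le {d ℓ : ℕ} (hd : 3 ≤ d) (hℓ : 2 ≤ ℓ) (k : ℕ) :
    ((Nat.digits ℓ k).map fun a => (a + d - 1).choose a).prod ≤ (k + d - 1).choose k := by
  induction k using Nat.strong_induction_on with
  | _ k ih =>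
    rcases Nat.eq_zero_or_pos k with rfl | hk
    · simp
    rw [Nat.digits_def' (by omega) hk, List.map_cons, List.prod_cons]
    rcases Nat.eq_zero_or_pos (k / ℓ) with h0 | h0
    · rw [h0, Nat.mod_eq_of_lt ((Nat.div_eq_zero_iff_lt (by omega)).1 h0)]
      simp
    · calc _ ≤ _ := Nat.mul_le_mul_left _ (ih _ (Nat.div_lt_self hk (by omega)))
        _ ≤ _ := (choose_mul_choose_lt hd hℓ (Nat.mod_lt k (by omega)) h0).le
        _ = _ := by rw [Nat.mod_add_div]

lemma prod_digits_choose_lt {d ℓ k : ℕ} (hd : 3 ≤ d) (hℓ : 2 ≤ ℓ) (hk : ℓ ≤ k) :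
    ((Nat.digits ℓ k).map fun a => (a + d - 1).choose a).prod < (k + d - 1).choose k := by
  rw [Nat.digits_def' (by omega) (by omega), List.map_cons, List.prod_cons]
  calc _ ≤ _ := Nat.mul_le_mul_left _ (prod_digits_choose_le hd hℓ _)
    _ < _ := choose_mul_choose_lt hd hℓ (Nat.mod_lt k (by omega)) (Nat.div_pos hk (by omega))
    _ = _ := by rw [Nat.mod_add_div]

open MvPolynomial in
lemma isHomogeneous_matSubst (g : Matrix (Fin d) (Fin d) F) {n : ℕ}
    {p : MvPolynomial (Fin d) F} (hp : p.IsHomogeneous n) : (matSubst g p).IsHomogeneous n := by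
  have h := hp.aeval (n := 1) (fun i => ∑ j, C (g j i) * X j) fun i =>
    IsHomogeneous.sum _ _ _ fun j _ => isHomogeneous_C_mul_X _ _
  rwa [one_mul] at h

/-- The subspace `Sym^a(V) ⬝ Sym^m(V)^{(ℓ)}` of `Sym^{a + ℓ m}(V)`. -/
def frobeniusSubmodule (F : Type*) [Field F] (d ℓ a m : ℕ) :
    Submodule F (MvPolynomial (Fin d) F) :=
  Submodule.span F {f | ∃ p q : MvPolynomial (Fin d) F,
    p.IsHomogeneous a ∧ q.IsHomogeneous m ∧ f = p * q ^ ℓ}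

lemma frobeniusSubmodule_le_symPow (ℓ a m : ℕ) :
    frobeniusSubmodule F d ℓ a m ≤ symPow F d (a + ℓ * m) := by
  rw [frobeniusSubmodule, Submodule.span_le]
  rintro _ ⟨p, q, hp, hq, rfl⟩
  have h := hp.mul (hq.pow ℓ)
  rwa [mul_comm m ℓ] at h

lemma symInvariant_frobeniusSubmodule (G : Subgroup (GL (Fin d) F)) (ℓ a m : ℕ) :
    SymInvariant G (frobeniusSubmodule F d ℓ a m) := by
  intro g _
  change frobeniusSubmodule F d ℓ a m ≤
    (frobeniusSubmodule F d ℓ a m).comap (matSubst (g : Matrix (Fin d) (Fin d) F)).toLinearMap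
  conv_lhs => rw [frobeniusSubmodule]
  rw [Submodule.span_le]
  rintro _ ⟨p, q, hp, hq, rfl⟩
  exact Submodule.subset_span
    ⟨matSubst (g : Matrix (Fin d) (Fin d) F) p, matSubst (g : Matrix (Fin d) (Fin d) F) q,
      isHomogeneous_matSubst _ hp, isHomogeneous_matSubst _ hq, by simp⟩

lemma frobeniusSubmodule_ne_bot (hd : 0 < d) (ℓ a m : ℕ) : frobeniusSubmodule F d ℓ a m ≠ ⊥ := by
  let x : MvPolynomial (Fin d) F := MvPolynomial.X ⟨0, hd⟩
  have hx (n : ℕ) : x ^ n ≠ 0 := pow_ne_zero n (MvPolynomial.X_ne_zero _)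
  have hmem : x ^ a * (x ^ m) ^ ℓ ∈ frobeniusSubmodule F d ℓ a m :=
    Submodule.subset_span ⟨x ^ a, x ^ m, MvPolynomial.isHomogeneous_X_pow _ _,
      MvPolynomial.isHomogeneous_X_pow _ _, rfl⟩
  exact (Submodule.ne_bot_iff _).2 ⟨_, hmem, mul_ne_zero (hx a) (pow_ne_zero ℓ (hx m))⟩

lemma coeff_pow_char_eq_zero {σ : Type*} {ℓ : ℕ} [ExpChar F ℓ] (q : MvPolynomial σ F)
    {α : σ →₀ ℕ} (hα : ∀ γ : σ →₀ ℕ, ℓ • γ ≠ α) : (q ^ ℓ).coeff α = 0 := by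
  classical
  rw [← MvPolynomial.map_frobenius_expand ℓ, MvPolynomial.coeff_map]
  have : α ∉ (q.expand ℓ).support := fun h => by
    rw [MvPolynomial.support_expand q (expChar_pos F ℓ).ne', Finset.mem_image] at h
    obtain ⟨γ, -, hγ⟩ := h
    exact hα γ hγ
  rw [MvPolynomial.notMem_support_iff.1 this, map_zero]

lemma coeff_eq_zero_of_mem_frobeniusSubmodule {ℓ a m : ℕ} [ExpChar F ℓ] {α : Fin d →₀ ℕ}
    (hα : ∀ β γ : Fin d →₀ ℕ, β.degree = a → β + ℓ • γ ≠ α) {f : MvPolynomial (Fin d) F}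
    (hf : f ∈ frobeniusSubmodule F d ℓ a m) : f.coeff α = 0 := by
  classical
  suffices frobeniusSubmodule F d ℓ a m ≤ LinearMap.ker (MvPolynomial.lcoeff F α) from this hf
  rw [frobeniusSubmodule, Submodule.span_le]
  rintro _ ⟨p, q, hp, -, rfl⟩
  change (p * q ^ ℓ).coeff α = 0
  rw [MvPolynomial.coeff_mul]
  refine Finset.sum_eq_zero fun x hx => ?_
  rw [Finset.HasAntidiagonal.mem_antidiagonal] at hx
  by_cases hdeg : x.1.degree = a
  · rw [coeff_pow_char_eq_zero q fun γ hγ => hα x.1 γ hdeg (by rw [hγ, hx]), mul_zero]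
  · rw [hp.coeff_eq_zero hdeg, zero_mul]

/-- In characteristic `ℓ ≤ k`, no subgroup of `GL(V)` acts irreducibly on `Sym^k(V)` when
`dim V ≥ 3`. -/
lemma not_symIrreducible_of_char_le {ℓ k : ℕ} [CharP F ℓ] (hℓ : ℓ.Prime) (hd : 3 ≤ d)
    (hk : ℓ ≤ k) (G : Subgroup (GL (Fin d) F)) : ¬ SymIrreducible G k := by
  rintro ⟨-, hG⟩
  have : ExpChar F ℓ := ExpChar.prime hℓ
  obtain ⟨α, hα, hne⟩ := exists_degree_eq_forall_add_nsmul_ne hd hℓ.two_le (Nat.mod_lt k hℓ.pos)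
    (Nat.div_pos hk hℓ.pos)
  have hle := frobeniusSubmodule_le_symPow (F := F) (d := d) ℓ (k % ℓ) (k / ℓ)
  rw [Nat.mod_add_div] at hα hle
  rcases hG _ hle (symInvariant_frobeniusSubmodule G _ _ _) with h | h
  · exact frobeniusSubmodule_ne_bot (by omega) _ _ _ h
  · have hmem : MvPolynomial.monomial α (1 : F) ∈ symPow F d k :=
      MvPolynomial.isHomogeneous_monomial 1 hα
    rw [← h] at hmem
    simpa using coeff_eq_zero_of_mem_frobeniusSubmodule hne hmem

/-- **Lemma (Guralnick–Tiep, Lemma `step1`(i)).**  Let `F` be an algebraically closed field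
and `V = F^d` with `d ≥ 3`.  If `Sym^k(V)` is irreducible over a subgroup `G ≤ GL(V)` for
some `k ≥ 2`, then `char(F) = 0` or `char(F) > k`.  In particular, if `0 < char(F) = ℓ ≤ k`
and `d ≥ 3`, then `Sym^k(V)` is reducible already over `SL(V)`, and writing `k` in base `ℓ`
with digits `a₀, a₁, …, a_s`, one has
`dim Sym^{a₀}(V) ⬝ dim Sym^{a₁}(V) ⬝ … ⬝ dim Sym^{a_s}(V) < dim Sym^k(V)`
(where `dim Sym^a(F^d) = C(a + d - 1, a)`). -/
theorem char_gt_k_of_symPow_irreducible (F : Type*) [Field F] [IsAlgClosed F] :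
    (∀ (d k : ℕ) (G : Subgroup (GL (Fin d) F)), 3 ≤ d → 2 ≤ k → SymIrreducible G k →
      ringChar F = 0 ∨ k < ringChar F) ∧
    (∀ d k : ℕ, 3 ≤ d → 0 < ringChar F → ringChar F ≤ k →
      ¬ SymIrreducible (SLsub F d) k ∧
      ((Nat.digits (ringChar F) k).map fun a => Nat.choose (a + d - 1) a).prod <
        Nat.choose (k + d - 1) k) := by
  have hprime : 0 < ringChar F → (ringChar F).Prime := fun h =>
    (CharP.char_is_prime_or_zero F (ringChar F)).resolve_right h.ne'
  refine ⟨fun d k G hd _ hG => ?_, fun d k hd hpos hk =>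
    ⟨not_symIrreducible_of_char_le (hprime hpos) hd hk _,
      prod_digits_choose_lt hd (hprime hpos).two_le hk⟩⟩
  by_contra! h
  exact not_symIrreducible_of_char_le (hprime (Nat.pos_of_ne_zero h.1)) hd h.2 G hG

end GuralnickTiep
end
end

section
/- Let F be an algebraically closed field, V an F-vector space with dim(V) ≥ 2, and G ≤ GL(V) a subgroup such that Sym^k(V) is irreducible over G for some k ≥ 2. Then G satisfies hypothesis (S): the G-module V is irreducible, primitive, tensor indecomposable, and not tensor induced. -/
open scoped TensorProduct
open Matrix

noncomputable section

namespace GuralnickTiep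

variable {F : Type*} [Field F] {d : ℕ}

variable (F d) in
/-- the natural module `V = F^d` is irreducible over `G ≤ GL(V)`. -/
def NatIrreducible (G : Subgroup (GL (Fin d) F)) : Prop :=
  (⊤ : Submodule F (Fin d → F)) ≠ ⊥ ∧
    ∀ W : Submodule F (Fin d → F),
      (∀ g ∈ G, ∀ v ∈ W,
        ((g : GL (Fin d) F) : Matrix (Fin d) (Fin d) F).mulVec v ∈ W) →
      W = ⊥ ∨ W = ⊤

variable (F d) in
/-- the natural module `V = F^d` is imprimitive over `G`: `V` is a direct sum of `n ≥ 2`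
nonzero subspaces permuted transitively by `G`. -/
def NatImprimitive (G : Subgroup (GL (Fin d) F)) : Prop :=
  ∃ (n : ℕ) (W : Fin n → Submodule F (Fin d → F)), 2 ≤ n ∧ (∀ i, W i ≠ ⊥) ∧
    (⨆ i, W i) = ⊤ ∧ (∀ i, W i ⊓ (⨆ j, ⨆ _ : j ≠ i, W j) = ⊥) ∧
    (∀ g ∈ G, ∀ i, ∃ j,
      Submodule.map
        (Matrix.mulVecLin ((g : GL (Fin d) F) : Matrix (Fin d) (Fin d) F)) (W i) = W j) ∧
    (∀ i j : Fin n, ∃ g ∈ G,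
      Submodule.map
        (Matrix.mulVecLin ((g : GL (Fin d) F) : Matrix (Fin d) (Fin d) F)) (W i) = W j)

variable (F d) in
/-- the natural module `V = F^d` is tensor decomposable over `G`: `V ≅ A ⊗ B` as `G`-modules
with `dim A, dim B > 1`. -/
def NatTensorDecomposable (G : Subgroup (GL (Fin d) F)) : Prop :=
  ∃ (m n : ℕ), 2 ≤ m ∧ 2 ≤ n ∧
    ∃ e : (Fin d → F) ≃ₗ[F] ((Fin m → F) ⊗[F] (Fin n → F)),
      ∀ g ∈ G, ∃ (a : (Fin m → F) →ₗ[F] (Fin m → F)) (b : (Fin n → F) →ₗ[F] (Fin n → F)),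
        ∀ v : Fin d → F,
          e (((g : GL (Fin d) F) : Matrix (Fin d) (Fin d) F).mulVec v) =
            TensorProduct.map a b (e v)

variable (F d) in
/-- the natural module `V = F^d` is tensor induced over `G`: `V = V₁ ⊗ ⋯ ⊗ V_m` with `m > 1`
spaces of equal dimension `f`, and `G ≤ (⊗ᵢ GL(Vᵢ))·S_m`, with `S_m` permuting the factors. -/
def NatTensorInduced (G : Subgroup (GL (Fin d) F)) : Prop :=
  ∃ (m f : ℕ), 2 ≤ m ∧ 2 ≤ f ∧
    ∃ e : (Fin d → F) ≃ₗ[F] (⨂[F] (_ : Fin m), (Fin f → F)),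
      ∀ g ∈ G, ∃ (σ : Equiv.Perm (Fin m)) (b : Fin m → ((Fin f → F) →ₗ[F] (Fin f → F))),
        ∀ v : Fin d → F,
          e (((g : GL (Fin d) F) : Matrix (Fin d) (Fin d) F).mulVec v) =
            PiTensorProduct.map b
              ((PiTensorProduct.reindex F (fun _ : Fin m => (Fin f → F)) σ) (e v))

variable (F d) in
/-- Hypothesis (S): the `G`-module `V` is irreducible, primitive, tensor indecomposable, and
not tensor induced. -/
def HypothesisS (G : Subgroup (GL (Fin d) F)) : Prop :=
  NatIrreducible F d G ∧ ¬ NatImprimitive F d G ∧ ¬ NatTensorDecomposable F d G ∧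
    ¬ NatTensorInduced F d G

/-- The linear form `∑ i, v i • X i` corresponding to a vector `v`. -/
def linForm (v : Fin d → F) : MvPolynomial (Fin d) F :=
  ∑ i, MvPolynomial.C (v i) * MvPolynomial.X i

/-- Evaluation of polynomials, viewed as elements of `Sym(V)`, at a functional on `V`. -/
def evalDual (φ : Module.Dual F (Fin d → F)) : MvPolynomial (Fin d) F →ₐ[F] F :=
  MvPolynomial.aeval fun i => φ (Pi.single i 1)

lemma evalDual_linForm (φ : Module.Dual F (Fin d → F)) (v : Fin d → F) :
    evalDual φ (linForm v) = φ v := by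
  conv_rhs => rw [pi_eq_sum_univ' v]
  simp [evalDual, linForm, map_sum]

lemma linForm_isHomogeneous (v : Fin d → F) : (linForm v).IsHomogeneous 1 :=
  MvPolynomial.IsHomogeneous.sum _ _ _ fun i _ => MvPolynomial.isHomogeneous_C_mul_X (v i) i

lemma matSubst_X (g : Matrix (Fin d) (Fin d) F) (i : Fin d) :
    matSubst g (MvPolynomial.X i) = linForm (g.mulVec (Pi.single i 1)) := by
  simp [matSubst, linForm]

lemma evalDual_matSubst (φ : Module.Dual F (Fin d → F)) (g : Matrix (Fin d) (Fin d) F)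
    (p : MvPolynomial (Fin d) F) :
    evalDual φ (matSubst g p) = evalDual (φ ∘ₗ g.mulVecLin) p := by
  have h : (evalDual φ).comp (matSubst g) = evalDual (φ ∘ₗ g.mulVecLin) := by
    ext i
    rw [AlgHom.comp_apply, matSubst_X, evalDual_linForm]
    simp [evalDual]
  exact DFunLike.congr_fun h p

lemma matSubst_mem_symPow (g : Matrix (Fin d) (Fin d) F) {k : ℕ} {p : MvPolynomial (Fin d) F}
    (hp : p ∈ symPow F d k) : matSubst g p ∈ symPow F d k := by
  rw [MvPolynomial.mem_homogeneousSubmodule] at hp ⊢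
  have h := hp.aeval (fun i => ∑ j, MvPolynomial.C (g j i) * MvPolynomial.X j)
    fun i => linForm_isHomogeneous fun j => g j i
  rwa [one_mul] at h

/-- If `Sym^k(V)` is irreducible, no nonzero form of degree `k` vanishes on a `G`-stable set of
functionals containing a nonzero one. -/
lemma SymIrreducible.eq_zero_of_vanishing {G : Subgroup (GL (Fin d) F)} {k : ℕ}
    (hirr : SymIrreducible G k) (Z : Set (Module.Dual F (Fin d → F)))
    (hZ : ∀ g ∈ G, ∀ φ ∈ Z, φ ∘ₗ (g : Matrix (Fin d) (Fin d) F).mulVecLin ∈ Z)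
    {φ₀ : Module.Dual F (Fin d → F)} (hφ₀ : φ₀ ∈ Z) (hne : φ₀ ≠ 0)
    {p : MvPolynomial (Fin d) F} (hp : p ∈ symPow F d k) (hpZ : ∀ φ ∈ Z, evalDual φ p = 0) :
    p = 0 := by
  let W : Submodule F (MvPolynomial (Fin d) F) :=
    symPow F d k ⊓ ⨅ φ ∈ Z, LinearMap.ker (evalDual φ).toLinearMap
  have mem_W (q) : q ∈ W ↔ q ∈ symPow F d k ∧ ∀ φ ∈ Z, evalDual φ q = 0 := by
    simp [W, Submodule.mem_inf, Submodule.mem_iInf]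
  have hW : SymInvariant G W := fun g hg q hq => by
    rw [mem_W] at hq ⊢
    refine ⟨matSubst_mem_symPow _ hq.1, fun φ hφ => ?_⟩
    rw [evalDual_matSubst]
    exact hq.2 _ (hZ g hg φ hφ)
  rcases hirr.2 W inf_le_left hW with h | h
  · rw [← Submodule.mem_bot F, ← h, mem_W]
    exact ⟨hp, hpZ⟩
  · obtain ⟨v, hv⟩ : ∃ v, φ₀ v ≠ 0 := by
      by_contra! hcon
      exact hne (LinearMap.ext hcon)
    have hvk : linForm v ^ k ∈ W := by
      rw [h, MvPolynomial.mem_homogeneousSubmodule]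
      simpa using (linForm_isHomogeneous v).pow k
    have := ((mem_W _).1 hvk).2 φ₀ hφ₀
    rw [map_pow, evalDual_linForm] at this
    exact absurd this (pow_ne_zero _ hv)

/-- A quadratic relation of the form `u₁ u₂ = u₃ u₄` holding on a nontrivial `G`-stable set of
functionals holds at every functional that is nonzero at `u₁`. -/
lemma SymIrreducible.quadric {G : Subgroup (GL (Fin d) F)} {k : ℕ} (hk : 2 ≤ k)
    (hirr : SymIrreducible G k) (Z : Set (Module.Dual F (Fin d → F)))
    (hZ : ∀ g ∈ G, ∀ φ ∈ Z, φ ∘ₗ (g : Matrix (Fin d) (Fin d) F).mulVecLin ∈ Z)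
    {φ₀ : Module.Dual F (Fin d → F)} (hφ₀ : φ₀ ∈ Z) (hne : φ₀ ≠ 0)
    {u₁ u₂ u₃ u₄ : Fin d → F} (hu : ∀ φ ∈ Z, φ u₁ * φ u₂ = φ u₃ * φ u₄)
    {φ : Module.Dual F (Fin d → F)} (hφ : φ u₁ ≠ 0) : φ u₁ * φ u₂ = φ u₃ * φ u₄ := by
  have hp := hirr.eq_zero_of_vanishing Z hZ hφ₀ hne
    (p := (linForm u₁ * linForm u₂ - linForm u₃ * linForm u₄) * linForm u₁ ^ (k - 2)) (by
      rw [MvPolynomial.mem_homogeneousSubmodule]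
      have h := (((linForm_isHomogeneous u₁).mul (linForm_isHomogeneous u₂)).sub
        ((linForm_isHomogeneous u₃).mul (linForm_isHomogeneous u₄))).mul
        ((linForm_isHomogeneous u₁).pow (k - 2))
      rwa [show 1 + 1 + 1 * (k - 2) = k by omega] at h)
    fun ψ hψ => by simp [evalDual_linForm, hu ψ hψ]
  have h := congrArg (evalDual φ) hp
  simpa [evalDual_linForm, hφ, sub_eq_zero] using h

lemma SymIrreducible.natIrreducible {G : Subgroup (GL (Fin d) F)} {k : ℕ} (hd : 2 ≤ d)
    (hk : 2 ≤ k) (hirr : SymIrreducible G k) : NatIrreducible F d G := by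
  have : Nonempty (Fin d) := ⟨⟨0, by omega⟩⟩
  refine ⟨top_ne_bot, fun W hW => ?_⟩
  by_contra! hcon
  obtain ⟨w, hw, hw0⟩ := W.exists_mem_ne_zero_of_ne_bot hcon.1
  obtain ⟨φ₀, hne, hφ₀⟩ := W.exists_le_ker_of_lt_top (lt_top_iff_ne_top.2 hcon.2)
  obtain ⟨φ, hφ⟩ : ∃ φ : Module.Dual F (Fin d → F), φ w ≠ 0 := by
    by_contra! h
    exact hw0 ((Module.forall_dual_apply_eq_zero_iff F w).1 h)
  have h := hirr.quadric hk {φ | W ≤ LinearMap.ker φ}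
    (fun g hg φ hφ v hv => hφ (hW g hg v hv)) hφ₀ hne (u₁ := w) (u₂ := w) (u₃ := 0) (u₄ := 0)
    (fun φ hφ => by simp [LinearMap.mem_ker.1 (hφ hw)]) hφ
  simp [hφ] at h

lemma SymIrreducible.not_natImprimitive {G : Subgroup (GL (Fin d) F)} {k : ℕ}
    (hk : 2 ≤ k) (hirr : SymIrreducible G k) : ¬ NatImprimitive F d G := by
  rintro ⟨n, W, hn, hW, -, hind, hperm, -⟩
  have sep (i : Fin n) : ∃ w ∈ W i, ∃ φ : Module.Dual F (Fin d → F), φ w ≠ 0 ∧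
      ∀ j ≠ i, W j ≤ LinearMap.ker φ := by
    obtain ⟨w, hw, hw0⟩ := (W i).exists_mem_ne_zero_of_ne_bot (hW i)
    have hnot : w ∉ ⨆ j, ⨆ _ : j ≠ i, W j := fun h => hw0 <| by
      rw [← Submodule.mem_bot F, ← hind i]
      exact ⟨hw, h⟩
    obtain ⟨φ, hφ, hle⟩ := Submodule.exists_le_ker_of_notMem hnot
    exact ⟨w, hw, φ, hφ, fun j hj => (le_iSup₂_of_le j hj le_rfl).trans hle⟩
  have hinj : Function.Injective W := fun i j hij => by
    by_contra hne
    refine hW j (le_bot_iff.1 ?_)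
    rw [← hind j]
    exact le_inf le_rfl (hij.symm.le.trans (le_iSup₂_of_le i hne le_rfl))
  have hZ : ∀ g ∈ G, ∀ φ ∈ {φ : Module.Dual F (Fin d → F) | ∃ i, ∀ j ≠ i, W j ≤ LinearMap.ker φ},
      φ ∘ₗ (g : Matrix (Fin d) (Fin d) F).mulVecLin ∈
        {φ : Module.Dual F (Fin d → F) | ∃ i, ∀ j ≠ i, W j ≤ LinearMap.ker φ} := by
    rintro g hg φ ⟨i, hi⟩
    have hginj : Function.Injective (g : Matrix (Fin d) (Fin d) F).mulVecLin :=
      Matrix.mulVec_injective_of_isUnit g.isUnit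
    have hle (j l) (hl : l ≠ i) (hjl : Submodule.map (g : Matrix (Fin d) (Fin d) F).mulVecLin
        (W j) = W l) :
        W j ≤ LinearMap.ker (φ ∘ₗ (g : Matrix (Fin d) (Fin d) F).mulVecLin) := fun v hv =>
      hi l hl (hjl ▸ Submodule.mem_map_of_mem hv)
    by_cases h : ∃ i', Submodule.map (g : Matrix (Fin d) (Fin d) F).mulVecLin (W i') = W i
    · obtain ⟨i', hi'⟩ := h
      refine ⟨i', fun j hj => ?_⟩
      obtain ⟨l, hl⟩ := hperm g hg j
      refine hle j l ?_ hl
      rintro rfl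
      exact hj (hinj (Submodule.map_injective_of_injective hginj (hl.trans hi'.symm)))
    · push Not at h
      refine ⟨i, fun j _ => ?_⟩
      obtain ⟨l, hl⟩ := hperm g hg j
      refine hle j l ?_ hl
      rintro rfl
      exact h j hl
  obtain ⟨w₀, hw₀, φ₀, hφ₀, hker₀⟩ := sep ⟨0, by omega⟩
  obtain ⟨w₁, hw₁, φ₁, hφ₁, hker₁⟩ := sep ⟨1, by omega⟩
  have h10 : φ₁ w₀ = 0 := hker₁ _ (by simp) hw₀
  have h01 : φ₀ w₁ = 0 := hker₀ _ (by simp) hw₁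
  have h := hirr.quadric hk _ hZ ⟨_, hker₀⟩ (by rintro rfl; simp at hφ₀)
    (u₁ := w₀) (u₂ := w₁) (u₃ := 0) (u₄ := 0) (φ := φ₀ + φ₁) (by
      rintro φ ⟨i, hi⟩
      by_cases h0 : (⟨0, by omega⟩ : Fin n) = i
      · have : φ w₁ = 0 := hi ⟨1, by omega⟩ (by simp [← h0]) hw₁
        simp [this]
      · have : φ w₀ = 0 := hi _ h0 hw₀
        simp [this]) (by simpa [h10] using hφ₀)
  simp [h10, h01, hφ₀, hφ₁] at h

/-- The functional `x ⊗ y ↦ α x * β y`. -/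
def pureDual {m n : ℕ} (α : Module.Dual F (Fin m → F)) (β : Module.Dual F (Fin n → F)) :
    Module.Dual F ((Fin m → F) ⊗[F] (Fin n → F)) :=
  TensorProduct.dualDistrib F _ _ (α ⊗ₜ β)

lemma pureDual_tmul {m n : ℕ} (α : Module.Dual F (Fin m → F)) (β : Module.Dual F (Fin n → F))
    (x : Fin m → F) (y : Fin n → F) : pureDual α β (x ⊗ₜ y) = α x * β y :=
  TensorProduct.dualDistrib_apply ..

lemma SymIrreducible.not_natTensorDecomposable {G : Subgroup (GL (Fin d) F)} {k : ℕ}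
    (hk : 2 ≤ k) (hirr : SymIrreducible G k) : ¬ NatTensorDecomposable F d G := by
  rintro ⟨m, n, hm, hn, e, he⟩
  let i₀ : Fin m := ⟨0, by omega⟩
  let i₁ : Fin m := ⟨1, by omega⟩
  let j₀ : Fin n := ⟨0, by omega⟩
  let j₁ : Fin n := ⟨1, by omega⟩
  have hi : i₀ ≠ i₁ := by simp [i₀, i₁]
  have hj : j₀ ≠ j₁ := by simp [j₀, j₁]
  let u (i : Fin m) (j : Fin n) : Fin d → F := e.symm (Pi.single i 1 ⊗ₜ Pi.single j 1)
  let P (i : Fin m) (j : Fin n) : Module.Dual F (Fin d → F) :=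
    pureDual (LinearMap.proj i) (LinearMap.proj j) ∘ₗ e.toLinearMap
  have hPu (i j i' j') : P i j (u i' j') =
      (Pi.single i' 1 : Fin m → F) i * (Pi.single j' 1 : Fin n → F) j := by
    simp [P, u, pureDual_tmul]
  have h := hirr.quadric hk {φ | ∃ α β, φ = pureDual α β ∘ₗ e.toLinearMap} (φ₀ := P i₀ j₀)
    (by
      rintro g hg _ ⟨α, β, rfl⟩
      obtain ⟨a, b, hab⟩ := he g hg
      have hcomp : pureDual α β ∘ₗ TensorProduct.map a b = pureDual (α ∘ₗ a) (β ∘ₗ b) := by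
        ext x y
        simp [pureDual_tmul]
      refine ⟨α ∘ₗ a, β ∘ₗ b, LinearMap.ext fun v => ?_⟩
      simp [← hcomp, hab])
    ⟨_, _, rfl⟩ (fun h => by simpa [h] using hPu i₀ j₀ i₀ j₀)
    (u₁ := u i₀ j₀) (u₂ := u i₁ j₁) (u₃ := u i₀ j₁) (u₄ := u i₁ j₀) (φ := P i₀ j₀ + P i₁ j₁)
    (by
      rintro _ ⟨α, β, rfl⟩
      simp only [u, LinearMap.comp_apply, LinearEquiv.coe_coe, LinearEquiv.apply_symm_apply,
        pureDual_tmul]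
      ring)
    (by simp [hPu, hi.symm])
  simp [hPu, hi, hi.symm, hj, hj.symm] at h

/-- The functional `⨂ xᵢ ↦ ∏ αᵢ xᵢ`. -/
def piPureDual {m f : ℕ} (α : Fin m → Module.Dual F (Fin f → F)) :
    Module.Dual F (⨂[F] (_ : Fin m), (Fin f → F)) :=
  PiTensorProduct.lift ((MultilinearMap.mkPiAlgebra F (Fin m) F).compLinearMap α)

lemma piPureDual_tprod {m f : ℕ} (α : Fin m → Module.Dual F (Fin f → F))
    (x : Fin m → (Fin f → F)) :
    piPureDual α (PiTensorProduct.tprod F x) = ∏ i, α i (x i) := by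
  simp [piPureDual]

lemma piPureDual_map_reindex {m f : ℕ} (α : Fin m → Module.Dual F (Fin f → F))
    (b : Fin m → ((Fin f → F) →ₗ[F] (Fin f → F))) (σ : Equiv.Perm (Fin m))
    (t : ⨂[F] (_ : Fin m), (Fin f → F)) :
    piPureDual α (PiTensorProduct.map b
      ((PiTensorProduct.reindex F (fun _ : Fin m => (Fin f → F)) σ) t)) =
      piPureDual (fun i => α (σ i) ∘ₗ b (σ i)) t := by
  have h : piPureDual α ∘ₗ PiTensorProduct.map b ∘ₗ
      (PiTensorProduct.reindex F (fun _ : Fin m => (Fin f → F)) σ).toLinearMap =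
      piPureDual (fun i => α (σ i) ∘ₗ b (σ i)) := by
    refine PiTensorProduct.ext (MultilinearMap.ext fun x => ?_)
    simp only [LinearMap.compMultilinearMap_apply, LinearMap.comp_apply, LinearEquiv.coe_coe,
      PiTensorProduct.reindex_tprod, PiTensorProduct.map_tprod, piPureDual_tprod]
    exact (Fintype.prod_equiv σ _ _ fun i => by simp).symm
  exact LinearMap.congr_fun h t

lemma SymIrreducible.not_natTensorInduced {G : Subgroup (GL (Fin d) F)} {k : ℕ}
    (hk : 2 ≤ k) (hirr : SymIrreducible G k) : ¬ NatTensorInduced F d G := by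
  rintro ⟨m, f, hm, hf, e, he⟩
  let i₀ : Fin m := ⟨0, by omega⟩
  let i₁ : Fin m := ⟨1, by omega⟩
  let a : Fin f := ⟨0, by omega⟩
  let b : Fin f := ⟨1, by omega⟩
  have hi : i₀ ≠ i₁ := by simp [i₀, i₁]
  have hab : a ≠ b := by simp [a, b]
  let u (c : Fin m → Fin f) : Fin d → F :=
    e.symm (PiTensorProduct.tprod F fun i => Pi.single (c i) 1)
  let P (c : Fin m → Fin f) : Module.Dual F (Fin d → F) :=
    piPureDual (fun i => LinearMap.proj (c i)) ∘ₗ e.toLinearMap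
  have hPu (c c') : P c (u c') = if c = c' then 1 else 0 := by
    simp [P, u, piPureDual_tprod, Pi.single_apply, Finset.prod_ite_zero, funext_iff]
  let c₁ : Fin m → Fin f := fun _ => a
  let c₂ : Fin m → Fin f := fun i => if i = i₀ ∨ i = i₁ then b else a
  let c₃ : Fin m → Fin f := fun i => if i = i₀ then b else a
  let c₄ : Fin m → Fin f := fun i => if i = i₁ then b else a
  have h12 : c₁ ≠ c₂ := fun h => hab (by simpa [c₁, c₂] using congrFun h i₀)
  have h13 : c₁ ≠ c₃ := fun h => hab (by simpa [c₁, c₃] using congrFun h i₀)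
  have h23 : c₂ ≠ c₃ := fun h => hab.symm (by simpa [c₂, c₃, hi.symm] using congrFun h i₁)
  have h := hirr.quadric hk {φ | ∃ α, φ = piPureDual α ∘ₗ e.toLinearMap} (φ₀ := P c₁)
    (by
      rintro g hg _ ⟨α, rfl⟩
      obtain ⟨σ, β, hσ⟩ := he g hg
      refine ⟨fun i => α (σ i) ∘ₗ β (σ i), LinearMap.ext fun v => ?_⟩
      simp [hσ, piPureDual_map_reindex])
    ⟨_, rfl⟩ (fun h => by simpa [h] using hPu c₁ c₁)
    (u₁ := u c₁) (u₂ := u c₂) (u₃ := u c₃) (u₄ := u c₄) (φ := P c₁ + P c₂)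
    (by
      rintro _ ⟨α, rfl⟩
      simp only [u, LinearMap.comp_apply, LinearEquiv.coe_coe, LinearEquiv.apply_symm_apply,
        piPureDual_tprod, ← Finset.prod_mul_distrib]
      refine Finset.prod_congr rfl fun i _ => ?_
      by_cases h0 : i = i₀
      · subst h0
        simp [c₁, c₂, c₃, c₄, hi, mul_comm]
      · simp [c₁, c₂, c₃, c₄, h0])
    (by simp [hPu, h12.symm])
  simp [hPu, h12, h12.symm, h13, h23] at h

/-- **Lemma (Guralnick–Tiep, Lemma `step1`(ii)).**  Let `F` be an algebraically closed field,
`V = F^d` with `d ≥ 2`, and `G ≤ GL(V)` a subgroup such that `Sym^k(V)` is irreducible over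
`G` for some `k ≥ 2`.  Then `G` satisfies hypothesis (S): the `G`-module `V` is irreducible,
primitive, tensor indecomposable, and not tensor induced. -/
theorem hypothesisS_of_symPow_irreducible (F : Type*) [Field F] [IsAlgClosed F] (d k : ℕ)
    (hd : 2 ≤ d) (hk : 2 ≤ k) (G : Subgroup (GL (Fin d) F)) (hirr : SymIrreducible G k) :
    HypothesisS F d G :=
  ⟨hirr.natIrreducible hd hk, hirr.not_natImprimitive hk, hirr.not_natTensorDecomposable hk,
    hirr.not_natTensorInduced hk⟩

end GuralnickTiep
end
end

section
/- Let F be an algebraically closed field with char(F) > 3 or char(F) = 0, V = F^d with d ≥ 3, and G ≤ GL(V) a subgroup such that ⋀^2(V) is irreducible over G. Then one of the following holds: (i) G satisfies hypothesis (S); (ii) V = V₁ ⊕ … ⊕ V_d is a direct sum of G-permuted 1-dimensional subspaces and G acts 2-homogeneously on {V₁,…,V_d}; (iii) V = V₁ ⊗ V₂ with G permuting V₁ and V₂ transitively, Sym^2(V_i) and ⋀^2(V_i) are irreducible over G₁ := Stab_G(V₁) ∩ Stab_G(V₂) for i = 1, 2, and moreover G is reducible on ⋀^3(V) if d ≥ 5.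 -/
open scoped TensorProduct
open Matrix

noncomputable section

namespace GuralnickTiep

variable {F : Type*} [Field F] {d : ℕ}

variable (F d) in
/-- Conclusion (ii) of Lemma `step1a`: `V` is a direct sum of `d` one-dimensional subspaces
permuted by `G`, and `G` acts 2-homogeneously on them. -/
def MonomialCase (G : Subgroup (GL (Fin d) F)) : Prop :=
  ∃ W : Fin d → Submodule F (Fin d → F),
    (∀ i, Module.finrank F ↥(W i) = 1) ∧ (⨆ i, W i) = ⊤ ∧
    (∀ i, W i ⊓ (⨆ j, ⨆ _ : j ≠ i, W j) = ⊥) ∧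
    (∀ g ∈ G, ∀ i, ∃ j,
      Submodule.map (Matrix.mulVecLin ((g : GL (Fin d) F) : Matrix (Fin d) (Fin d) F))
        (W i) = W j) ∧
    (∀ i j i' j' : Fin d, i ≠ j → i' ≠ j' → ∃ g ∈ G,
      (Submodule.map (Matrix.mulVecLin ((g : GL (Fin d) F) : Matrix (Fin d) (Fin d) F))
          (W i) = W i' ∧
        Submodule.map (Matrix.mulVecLin ((g : GL (Fin d) F) : Matrix (Fin d) (Fin d) F))
          (W j) = W j') ∨
      (Submodule.map (Matrix.mulVecLin ((g : GL (Fin d) F) : Matrix (Fin d) (Fin d) F))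
          (W i) = W j' ∧
        Submodule.map (Matrix.mulVecLin ((g : GL (Fin d) F) : Matrix (Fin d) (Fin d) F))
          (W j) = W i'))

variable (F) in
/-- `g ∈ GL(V)` acts on `V = V₁ ⊗ V₂` (via the identification `e`) as `a ⊗ b`. -/
def FactorWitness {d m : ℕ} (e : (Fin d → F) ≃ₗ[F] ((Fin m → F) ⊗[F] (Fin m → F)))
    (g : GL (Fin d) F) (a b : (Fin m → F) →ₗ[F] (Fin m → F)) : Prop :=
  ∀ v : Fin d → F,
    e (((g : GL (Fin d) F) : Matrix (Fin d) (Fin d) F).mulVec v) = TensorProduct.map a b (e v)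

variable (F) in
/-- `g ∈ GL(V)` acts on `V = V₁ ⊗ V₂` (via the identification `e`) as `a ⊗ b` composed with
the swap of the two factors. -/
def SwapWitness {d m : ℕ} (e : (Fin d → F) ≃ₗ[F] ((Fin m → F) ⊗[F] (Fin m → F)))
    (g : GL (Fin d) F) (a b : (Fin m → F) →ₗ[F] (Fin m → F)) : Prop :=
  ∀ v : Fin d → F,
    e (((g : GL (Fin d) F) : Matrix (Fin d) (Fin d) F).mulVec v) =
      TensorProduct.map a b
        ((TensorProduct.comm F (Fin m → F) (Fin m → F)) (e v))

variable (F d) in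
/-- Conclusion (iii) of Lemma `step1a`: `V = V₁ ⊗ V₂` with `G` permuting `V₁` and `V₂`
transitively, `Sym²(Vᵢ)` and `⋀²(Vᵢ)` are irreducible over `G₁ = Stab_G(V₁) ∩ Stab_G(V₂)`
for `i = 1,2`, and `G` is reducible on `⋀³(V)` if `d ≥ 5`. -/
def TensorSwapCase (G : Subgroup (GL (Fin d) F)) : Prop :=
  ∃ m : ℕ, 2 ≤ m ∧ d = m * m ∧
  ∃ e : (Fin d → F) ≃ₗ[F] ((Fin m → F) ⊗[F] (Fin m → F)),
    (∀ g ∈ G, (∃ a b, FactorWitness F e g a b) ∨ (∃ a b, SwapWitness F e g a b)) ∧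
    (∃ g ∈ G, ∃ a b, SwapWitness F e g a b) ∧
    -- `Sym²(V₁)` is irreducible over `G₁`
    (symPow F m 2 ≠ ⊥ ∧ ∀ W : Submodule F (MvPolynomial (Fin m) F), W ≤ symPow F m 2 →
      (∀ g ∈ G, ∀ a b, FactorWitness F e g a b →
        ∀ p ∈ W, matSubst (LinearMap.toMatrix' a) p ∈ W) →
      W = ⊥ ∨ W = symPow F m 2) ∧
    -- `Sym²(V₂)` is irreducible over `G₁`
    (symPow F m 2 ≠ ⊥ ∧ ∀ W : Submodule F (MvPolynomial (Fin m) F), W ≤ symPow F m 2 →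
      (∀ g ∈ G, ∀ a b, FactorWitness F e g a b →
        ∀ p ∈ W, matSubst (LinearMap.toMatrix' b) p ∈ W) →
      W = ⊥ ∨ W = symPow F m 2) ∧
    -- `⋀²(V₁)` is irreducible over `G₁`
    ((⋀[F]^2 (Fin m → F)) ≠ ⊥ ∧
      ∀ W : Submodule F (ExteriorAlgebra F (Fin m → F)), W ≤ ⋀[F]^2 (Fin m → F) →
      (∀ g ∈ G, ∀ a b, FactorWitness F e g a b →
        ∀ p ∈ W, ExteriorAlgebra.map a p ∈ W) →
      W = ⊥ ∨ W = ⋀[F]^2 (Fin m → F)) ∧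
    -- `⋀²(V₂)` is irreducible over `G₁`
    ((⋀[F]^2 (Fin m → F)) ≠ ⊥ ∧
      ∀ W : Submodule F (ExteriorAlgebra F (Fin m → F)), W ≤ ⋀[F]^2 (Fin m → F) →
      (∀ g ∈ G, ∀ a b, FactorWitness F e g a b →
        ∀ p ∈ W, ExteriorAlgebra.map b p ∈ W) →
      W = ⊥ ∨ W = ⋀[F]^2 (Fin m → F)) ∧
    -- `G` is reducible on `⋀³(V)` if `d ≥ 5`
    (5 ≤ d → ¬ ExtIrreducible G 3)


/-! ### Orbits of multivectors -/

section Orbit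

variable {G : Subgroup (GL (Fin d) F)}

lemma ιMulti_ne_zero {P : Type*} [AddCommGroup P] [Module F P] {k : ℕ} {v : Fin k → P}
    (h : LinearIndependent F v) : ExteriorAlgebra.ιMulti F k v ≠ 0 := by
  have h1 := (exteriorPower.ιMulti_family_linearIndependent_field (n := k) h).ne_zero
    (Set.powersetCard.ofFinEmbEquiv (RelEmbedding.refl _))
  intro h0
  apply h1
  ext
  simpa [ExteriorAlgebra.ιMulti_family] using h0

/-- If the orbit of a nonzero `x ∈ ⋀^k V` is mapped into `W` by `D`, so is all of `⋀^k V`. -/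
lemma ExtIrreducible.map_mem {k : ℕ} (hirr : ExtIrreducible G k)
    {x : ExteriorAlgebra F (Fin d → F)} (hx : x ∈ ⋀[F]^k (Fin d → F)) (hx0 : x ≠ 0)
    {Z : Type*} [AddCommGroup Z] [Module F Z] (D : ExteriorAlgebra F (Fin d → F) →ₗ[F] Z)
    (W : Submodule F Z)
    (h : ∀ g ∈ G, D (extSubst ((g : GL (Fin d) F) : Matrix (Fin d) (Fin d) F) x) ∈ W) :
    ∀ z ∈ ⋀[F]^k (Fin d → F), D z ∈ W := by
  set S : Submodule F (ExteriorAlgebra F (Fin d → F)) := Submodule.span F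
    {y | ∃ g ∈ G, y = extSubst ((g : GL (Fin d) F) : Matrix (Fin d) (Fin d) F) x} with hS
  have hext : ∀ M : Matrix (Fin d) (Fin d) F, ∀ y ∈ ⋀[F]^k (Fin d → F),
      extSubst M y ∈ ⋀[F]^k (Fin d → F) := by
    intro M y hy
    rw [← ExteriorAlgebra.ιMulti_span_fixedDegree] at hy ⊢
    induction hy using Submodule.span_induction with
    | mem y hy =>
      obtain ⟨v, rfl⟩ := hy
      rw [extSubst, ExteriorAlgebra.map_apply_ιMulti]
      exact Submodule.subset_span ⟨_, rfl⟩
    | zero => simp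
    | add y z _ _ hy hz => rw [map_add]; exact add_mem hy hz
    | smul a y _ hy => rw [map_smul]; exact Submodule.smul_mem _ _ hy
  have hSk : S ≤ ⋀[F]^k (Fin d → F) := by
    rw [hS, Submodule.span_le]
    rintro y ⟨g, -, rfl⟩
    exact hext _ _ hx
  have hmul : ∀ (M N : Matrix (Fin d) (Fin d) F) y, extSubst M (extSubst N y) =
      extSubst (M * N) y := by
    intro M N y
    rw [extSubst, extSubst, extSubst, Matrix.mulVecLin_mul, ← ExteriorAlgebra.map_comp_map]
    rfl
  have hinv : ExtInvariant G S := by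
    intro g hg v hv
    induction hv using Submodule.span_induction with
    | mem y hy =>
      obtain ⟨g', hg', rfl⟩ := hy
      exact Submodule.subset_span ⟨g * g', mul_mem hg hg', by rw [hmul]; rfl⟩
    | zero => simp
    | add y z _ _ hy hz => rw [map_add]; exact add_mem hy hz
    | smul a y _ hy => rw [map_smul]; exact Submodule.smul_mem _ _ hy
  have hxS : x ∈ S := Submodule.subset_span ⟨1, one_mem _, by
    simp [extSubst]⟩
  rcases hirr.2 S hSk hinv with h0 | h1
  · rw [h0] at hxS
    exact absurd ((Submodule.mem_bot F).1 hxS) hx0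
  · intro z hz
    rw [← h1] at hz
    have : S ≤ W.comap D := by
      rw [hS, Submodule.span_le]
      rintro y ⟨g, hg, rfl⟩
      exact h g hg
    exact this hz

section

variable {P Z : Type*} [AddCommGroup P] [Module F P] [AddCommGroup Z] [Module F Z]

/-- The alternating map of two variables attached to a bilinear map vanishing on the diagonal. -/
def altOfBilin (D : P →ₗ[F] P →ₗ[F] Z) (hD : ∀ v, D v v = 0) : P [⋀^Fin 2]→ₗ[F] Z where
  toFun v := D (v 0) (v 1)
  map_update_add' := by
    intro inst v i x y
    rw [Subsingleton.elim inst (instDecidableEqFin 2)]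
    fin_cases i <;> simp
  map_update_smul' := by
    intro inst v i c x
    rw [Subsingleton.elim inst (instDecidableEqFin 2)]
    fin_cases i <;> simp
  map_eq_zero_of_eq' := by
    intro v i j h hij
    have h01 : v 0 = v 1 := by
      fin_cases i <;> fin_cases j <;> simp_all
    simp [h01, hD]

/-- The linear form on the exterior algebra attached to an alternating bilinear map. -/
def extOfBilin (D : P →ₗ[F] P →ₗ[F] Z) (hD : ∀ v, D v v = 0) :
    ExteriorAlgebra F P →ₗ[F] Z :=
  ExteriorAlgebra.liftAlternating (Pi.single 2 (altOfBilin D hD))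

lemma ιMulti_two (x y : P) :
    ExteriorAlgebra.ιMulti F 2 ![x, y] = ExteriorAlgebra.ι F x * ExteriorAlgebra.ι F y := by
  simp [ExteriorAlgebra.ιMulti_apply]

lemma extOfBilin_mul (D : P →ₗ[F] P →ₗ[F] Z) (hD : ∀ v, D v v = 0) (x y : P) :
    extOfBilin D hD (ExteriorAlgebra.ι F x * ExteriorAlgebra.ι F y) = D x y := by
  rw [← ιMulti_two, extOfBilin, ExteriorAlgebra.liftAlternating_apply_ιMulti, Pi.single_eq_same]
  rfl

variable (F P) in
/-- The bilinear map `(x, y) ↦ x ∧ y`. -/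
def wedge : P →ₗ[F] P →ₗ[F] ExteriorAlgebra F P :=
  (LinearMap.mul F (ExteriorAlgebra F P)).compl₁₂ (ExteriorAlgebra.ι F) (ExteriorAlgebra.ι F)

lemma wedge_apply (x y : P) :
    wedge F P x y = ExteriorAlgebra.ι F x * ExteriorAlgebra.ι F y := rfl

lemma wedge_self (x : P) : wedge F P x x = 0 := ExteriorAlgebra.ι_sq_zero x

lemma wedge_mem (t : P ⊗[F] P) : TensorProduct.lift (wedge F P) t ∈ ⋀[F]^2 P := by
  induction t using TensorProduct.induction_on with
  | zero => simp
  | tmul x y =>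
    rw [TensorProduct.lift.tmul, wedge_apply, ← ιMulti_two]
    exact ExteriorAlgebra.ιMulti_range F 2 ⟨_, rfl⟩
  | add x y hx hy => rw [map_add]; exact add_mem hx hy

lemma extOfBilin_wedge (D : P →ₗ[F] P →ₗ[F] Z) (hD : ∀ v, D v v = 0) (t : P ⊗[F] P) :
    extOfBilin D hD (TensorProduct.lift (wedge F P) t) = TensorProduct.lift D t := by
  induction t using TensorProduct.induction_on with
  | zero => simp
  | tmul x y => rw [TensorProduct.lift.tmul, wedge_apply, extOfBilin_mul, TensorProduct.lift.tmul]
  | add x y hx hy => rw [map_add, map_add, map_add, hx, hy]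

lemma map_wedge {Q : Type*} [AddCommGroup Q] [Module F Q] (f : P →ₗ[F] Q) (t : P ⊗[F] P) :
    ExteriorAlgebra.map f (TensorProduct.lift (wedge F P) t) =
      TensorProduct.lift (wedge F Q) (TensorProduct.map f f t) := by
  induction t using TensorProduct.induction_on with
  | zero => simp
  | tmul x y => simp [wedge_apply]
  | add x y hx hy => simp only [map_add, hx, hy]

/-- Bilinear form of `ExtIrreducible.map_mem` for `⋀²`, transported along `e : V ≃ P`. -/
lemma ExtIrreducible.bilin_mem (hirr : ExtIrreducible G 2) (e : (Fin d → F) ≃ₗ[F] P)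
    {Y : Type*} [AddCommGroup Y] [Module F Y]
    (t : P ⊗[F] P) (D₀ : P →ₗ[F] P →ₗ[F] Y) (hD₀ : ∀ v, D₀ v v = 0)
    (ht : TensorProduct.lift D₀ t ≠ 0)
    (D : P →ₗ[F] P →ₗ[F] Z) (hD : ∀ v, D v v = 0) (W : Submodule F Z)
    (h : ∀ g ∈ G, ∀ φ : P →ₗ[F] P,
      (∀ v, e (((g : GL (Fin d) F) : Matrix (Fin d) (Fin d) F).mulVec v) = φ (e v)) →
      TensorProduct.lift D (TensorProduct.map φ φ t) ∈ W) (x y : P) : D x y ∈ W := by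
  set E : ExteriorAlgebra F (Fin d → F) →ₐ[F] ExteriorAlgebra F P :=
    ExteriorAlgebra.map e.toLinearMap with hE
  set z := TensorProduct.lift (wedge F (Fin d → F))
    (TensorProduct.map e.symm.toLinearMap e.symm.toLinearMap t) with hz
  have hcomp : ∀ φ : (Fin d → F) →ₗ[F] P, TensorProduct.map φ φ
      (TensorProduct.map e.symm.toLinearMap e.symm.toLinearMap t) =
      TensorProduct.map (φ ∘ₗ e.symm.toLinearMap) (φ ∘ₗ e.symm.toLinearMap) t := by
    intro φ
    rw [TensorProduct.map_comp]; rfl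
  have hEz : E z = TensorProduct.lift (wedge F P) t := by
    rw [hE, hz, map_wedge, hcomp]
    simp
  have hz0 : z ≠ 0 := by
    intro h0
    apply ht
    rw [← extOfBilin_wedge D₀ hD₀, ← hEz, h0]
    simp
  have := hirr.map_mem (wedge_mem _) hz0 (extOfBilin D hD ∘ₗ E.toLinearMap) W (by
    intro g hg
    rw [LinearMap.comp_apply, extSubst, map_wedge, AlgHom.toLinearMap_apply, hE, map_wedge,
      extOfBilin_wedge, ← LinearMap.comp_apply (TensorProduct.map _ _), ← TensorProduct.map_comp,
      hcomp]
    refine h g hg _ fun v => ?_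
    simp) (ExteriorAlgebra.ι F (e.symm x) * ExteriorAlgebra.ι F (e.symm y))
    (by rw [← wedge_apply, ← TensorProduct.lift.tmul]; exact wedge_mem _)
  simpa [hE, extOfBilin_mul] using this

end

end Orbit

/-! ### Irreducibility and primitivity -/

section Primitive

variable {G : Subgroup (GL (Fin d) F)}

lemma wedge_ne_zero {P : Type*} [AddCommGroup P] [Module F P] {x y : P}
    (h : LinearIndependent F ![x, y]) : wedge F P x y ≠ 0 := by
  rw [wedge_apply, ← ιMulti_two]
  exact ιMulti_ne_zero h

lemma exists_linearIndependent_pair {P : Type*} [AddCommGroup P] [Module F P]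
    (h : 2 ≤ Module.finrank F P) : ∃ x y : P, LinearIndependent F ![x, y] := by
  obtain ⟨f, hf⟩ := exists_linearIndependent_of_le_finrank h
  refine ⟨f 0, f 1, ?_⟩
  convert hf using 1
  ext i
  fin_cases i <;> rfl

/-- The alternating bilinear map `(x, y) ↦ f x • y - f y • x`. -/
def contractBilin {P : Type*} [AddCommGroup P] [Module F P] (f : P →ₗ[F] F) : P →ₗ[F] P →ₗ[F] P :=
  LinearMap.lsmul F P ∘ₗ f - (LinearMap.lsmul F P ∘ₗ f).flip

lemma contractBilin_apply {P : Type*} [AddCommGroup P] [Module F P] (f : P →ₗ[F] F) (x y : P) :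
    contractBilin f x y = f x • y - f y • x := rfl

/-- The alternating bilinear form `f₁ ∧ f₂`. -/
def wedgeForm {P : Type*} [AddCommGroup P] [Module F P] (f₁ f₂ : P →ₗ[F] F) :
    P →ₗ[F] P →ₗ[F] F :=
  (LinearMap.mul F F).compl₁₂ f₁ f₂ - (LinearMap.mul F F).compl₁₂ f₂ f₁

lemma wedgeForm_apply {P : Type*} [AddCommGroup P] [Module F P] (f₁ f₂ : P →ₗ[F] F) (x y : P) :
    wedgeForm f₁ f₂ x y = f₁ x * f₂ y - f₂ x * f₁ y := rfl

lemma natIrreducible_of_ext2 (hd : 3 ≤ d) (hirr : ExtIrreducible G 2) : NatIrreducible F d G := by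
  have : Nonempty (Fin d) := ⟨⟨0, by omega⟩⟩
  refine ⟨top_ne_bot, fun W hW => ?_⟩
  by_contra! hne
  obtain ⟨hbot, htop⟩ := hne
  obtain ⟨v, -, hv⟩ := SetLike.exists_of_lt (lt_top_iff_ne_top.2 htop)
  have hrank := Submodule.finrank_quotient_add_finrank W
  rw [Module.finrank_fin_fun] at hrank
  by_cases h2 : 2 ≤ Module.finrank F W
  · obtain ⟨w₁, w₂, hw⟩ := exists_linearIndependent_pair h2
    obtain ⟨f, hfv, hfW⟩ := Submodule.exists_dual_map_eq_bot_of_notMem hv inferInstance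
    have hf : ∀ w ∈ W, f w = 0 := fun w hw => by
      have : f w ∈ W.map f := ⟨w, hw, rfl⟩
      rwa [hfW] at this
    have hind : LinearIndependent F ![(w₁ : Fin d → F), (w₂ : Fin d → F)] :=
      LinearIndependent.pair_iff.2 fun s t h => LinearIndependent.pair_iff.1 hw s t (Subtype.ext h)
    have := hirr.bilin_mem (LinearEquiv.refl F _) ((w₁ : Fin d → F) ⊗ₜ[F] (w₂ : Fin d → F))
      (wedge F _) wedge_self (by simpa using wedge_ne_zero hind)
      (contractBilin f) (by simp [contractBilin_apply]) ⊥ (by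
        intro g hg φ hφ
        have h1 := hf _ (hW g hg w₁ w₁.2)
        have h2 := hf _ (hW g hg w₂ w₂.2)
        simp only [LinearEquiv.refl_apply] at hφ
        simp [contractBilin_apply, ← hφ, h1, h2]) v w₁
    rw [Submodule.mem_bot, contractBilin_apply, hf w₁ w₁.2, zero_smul, sub_zero] at this
    rcases smul_eq_zero.1 this with h | h
    · exact hfv h
    · exact hind.ne_zero 0 h
  · obtain ⟨x, y, hxy⟩ : ∃ x y : (Fin d → F) ⧸ W, LinearIndependent F ![x, y] :=
      exists_linearIndependent_pair (by omega)
    obtain ⟨x, rfl⟩ := W.mkQ_surjective x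
    obtain ⟨y, rfl⟩ := W.mkQ_surjective y
    obtain ⟨w, hw, hw0⟩ := W.ne_bot_iff.1 hbot
    have hind : LinearIndependent F ![w, v] := by
      rw [LinearIndependent.pair_iff' hw0]
      rintro a rfl
      exact hv (W.smul_mem a hw)
    have := hirr.bilin_mem (LinearEquiv.refl F _) (w ⊗ₜ[F] v)
      (wedge F _) wedge_self (by simpa using wedge_ne_zero hind)
      ((wedge F _).compl₁₂ W.mkQ W.mkQ) (fun v => wedge_self _) ⊥ (by
        intro g hg φ hφ
        have h1 : W.mkQ (φ w) = 0 := by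
          rw [Submodule.mkQ_apply, Submodule.Quotient.mk_eq_zero]
          exact hφ w ▸ hW g hg w hw
        rw [TensorProduct.map_tmul, TensorProduct.lift.tmul, LinearMap.compl₁₂_apply, h1]
        simp) x y
    exact wedge_ne_zero hxy this

lemma monomialCase_of_imprimitive (hirr : ExtIrreducible G 2) (himp : NatImprimitive F d G) :
    MonomialCase F d G := by
  obtain ⟨n, W, hn, hbot, htop, hdisj, hperm, -⟩ := himp
  have hw : ∀ i, ∃ w ∈ W i, w ≠ 0 := fun i => (W i).ne_bot_iff.1 (hbot i)
  choose w hwW hw0 using hw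
  have hf : ∀ i, ∃ f : (Fin d → F) →ₗ[F] F, f (w i) ≠ 0 ∧ ∀ j ≠ i, ∀ x ∈ W j, f x = 0 := by
    intro i
    have hni : w i ∉ ⨆ j, ⨆ _ : j ≠ i, W j := fun h => hw0 i (by
      have : w i ∈ W i ⊓ (⨆ j, ⨆ _ : j ≠ i, W j) := ⟨hwW i, h⟩
      rwa [hdisj i] at this)
    obtain ⟨f, hf1, hf2⟩ := Submodule.exists_dual_map_eq_bot_of_notMem hni inferInstance
    refine ⟨f, hf1, fun j hj x hx => ?_⟩
    have : f x ∈ (⨆ j, ⨆ _ : j ≠ i, W j).map f :=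
      ⟨x, (le_iSup₂ (f := fun j (_ : j ≠ i) => W j) j hj) hx, rfl⟩
    rwa [hf2] at this
  choose f hfw hf0 using hf
  have hgW : ∀ g ∈ G, ∀ i, ∃ j, Submodule.map
      (Matrix.mulVecLin ((g : GL (Fin d) F) : Matrix (Fin d) (Fin d) F)) (W i) = W j ∧
      ∀ x ∈ W i, ((g : GL (Fin d) F) : Matrix (Fin d) (Fin d) F).mulVec x ∈ W j := by
    intro g hg i
    obtain ⟨j, hj⟩ := hperm g hg i
    exact ⟨j, hj, fun x hx => hj ▸ ⟨x, hx, rfl⟩⟩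
  have hform : ∀ i j, i ≠ j → wedgeForm (f i) (f j) (w i) (w j) ≠ 0 := by
    intro i j hij
    rw [wedgeForm_apply, hf0 j i hij _ (hwW i), zero_mul, sub_zero]
    exact mul_ne_zero (hfw i) (hfw j)
  have halt : ∀ i j v, wedgeForm (f i) (f j) v v = 0 := fun i j v => by
    rw [wedgeForm_apply]; ring
  -- all blocks are one-dimensional
  have hone : ∀ i, Module.finrank F (W i) = 1 := by
    intro i
    by_contra h1
    have h0 : 0 < Module.finrank F (W i) :=
      Nat.pos_of_ne_zero fun h => hbot i (Submodule.finrank_eq_zero.1 h)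
    obtain ⟨w₁, w₂, hind'⟩ := exists_linearIndependent_pair (F := F) (P := W i) (by omega)
    have hind : LinearIndependent F ![(w₁ : Fin d → F), (w₂ : Fin d → F)] :=
      LinearIndependent.pair_iff.2 fun s t h =>
        LinearIndependent.pair_iff.1 hind' s t (Subtype.ext h)
    have h01 : (⟨0, by omega⟩ : Fin n) ≠ ⟨1, by omega⟩ := by simp
    refine hform _ _ h01 <| hirr.bilin_mem (LinearEquiv.refl F _)
      ((w₁ : Fin d → F) ⊗ₜ[F] (w₂ : Fin d → F))
      (wedge F _) wedge_self (by simpa using wedge_ne_zero hind) (wedgeForm _ _) (halt _ _) ⊥ ?_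
      _ _
    intro g hg φ hφ
    simp only [LinearEquiv.refl_apply] at hφ
    obtain ⟨j, -, hj⟩ := hgW g hg i
    rw [TensorProduct.map_tmul, TensorProduct.lift.tmul, wedgeForm_apply, ← hφ, ← hφ,
      Submodule.mem_bot]
    have m1 := hj _ w₁.2
    have m2 := hj _ w₂.2
    by_cases hj0 : j = ⟨0, by omega⟩
    · have hj1 : j ≠ ⟨1, by omega⟩ := hj0 ▸ h01
      rw [hf0 _ j hj1 _ m1, hf0 _ j hj1 _ m2]; ring
    · rw [hf0 _ j hj0 _ m1, hf0 _ j hj0 _ m2]; ring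
  have hspan : ∀ i, W i = Submodule.span F {w i} := fun i =>
    (Submodule.eq_of_le_of_finrank_eq (by simpa using hwW i)
      (by rw [finrank_span_singleton (hw0 i), hone i])).symm
  have hlin : LinearIndependent F w := by
    have : iSupIndep W := fun i => disjoint_iff.2 (hdisj i)
    exact this.linearIndependent _ hwW hw0
  have hnd : n = d := by
    have hb := Module.finrank_eq_card_basis (Module.Basis.mk hlin (by
      rw [← htop]
      refine iSup_le fun i => ?_
      rw [hspan i]
      exact Submodule.span_mono (by rintro _ rfl; exact ⟨i, rfl⟩)))
    simpa using hb.symm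
  subst hnd
  refine ⟨W, hone, htop, hdisj, hperm, ?_⟩
  intro i j i' j' hij hij'
  by_contra! hcon
  have hind : LinearIndependent F ![w i, w j] := by
    rw [LinearIndependent.pair_iff' (hw0 i)]
    intro a ha
    refine hfw j ?_
    rw [← ha, map_smul, hf0 j i hij _ (hwW i), smul_zero]
  refine hform _ _ hij' <| hirr.bilin_mem (LinearEquiv.refl F _) (w i ⊗ₜ[F] w j)
    (wedge F _) wedge_self (by simpa using wedge_ne_zero hind) (wedgeForm _ _) (halt _ _) ⊥ ?_ _ _
  intro g hg φ hφ
  simp only [LinearEquiv.refl_apply] at hφ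
  obtain ⟨k, hk, hkm⟩ := hgW g hg i
  obtain ⟨l, hl, hlm⟩ := hgW g hg j
  have m1 := hkm _ (hwW i)
  have m2 := hlm _ (hwW j)
  obtain ⟨hc1, hc2⟩ := hcon g hg
  rw [TensorProduct.map_tmul, TensorProduct.lift.tmul, wedgeForm_apply, ← hφ, ← hφ,
    Submodule.mem_bot]
  have e1 : f i' (((g : GL (Fin n) F) : Matrix (Fin n) (Fin n) F).mulVec (w i)) *
      f j' (((g : GL (Fin n) F) : Matrix (Fin n) (Fin n) F).mulVec (w j)) = 0 := by
    by_cases hki : k = i'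
    · have hlj : l ≠ j' := fun h => hc1 (hki ▸ hk) (h ▸ hl)
      rw [hf0 _ l hlj _ m2, mul_zero]
    · rw [hf0 _ k hki _ m1, zero_mul]
  have e2 : f j' (((g : GL (Fin n) F) : Matrix (Fin n) (Fin n) F).mulVec (w i)) *
      f i' (((g : GL (Fin n) F) : Matrix (Fin n) (Fin n) F).mulVec (w j)) = 0 := by
    by_cases hki : k = j'
    · have hlj : l ≠ i' := fun h => hc2 (hki ▸ hk) (h ▸ hl)
      rw [hf0 _ l hlj _ m2, mul_zero]
    · rw [hf0 _ k hki _ m1, zero_mul]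
  rw [e1, e2, sub_zero]

end Primitive

/-! ### Tensor decompositions -/

section Tensor

variable {G : Subgroup (GL (Fin d) F)} {A B : Type*} [AddCommGroup A] [Module F A]
  [AddCommGroup B] [Module F B]

/-- The contraction `A ⊗ B → A` by a linear form on `B`. -/
def contractR (A : Type*) [AddCommGroup A] [Module F A] (ψ : B →ₗ[F] F) : A ⊗[F] B →ₗ[F] A :=
  (TensorProduct.rid F A).toLinearMap ∘ₗ LinearMap.lTensor A ψ

@[simp] lemma contractR_tmul (ψ : B →ₗ[F] F) (a : A) (b : B) :
    contractR A ψ (a ⊗ₜ b) = ψ b • a := by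
  simp [contractR]

/-- The alternating bilinear map `(x, y) ↦ c x ∧ c y`. -/
def wedgeComp {P : Type*} [AddCommGroup P] [Module F P] (c : P →ₗ[F] A) :
    P →ₗ[F] P →ₗ[F] ExteriorAlgebra F A :=
  (wedge F A).compl₁₂ c c

lemma wedgeComp_apply {P : Type*} [AddCommGroup P] [Module F P] (c : P →ₗ[F] A) (x y : P) :
    wedgeComp c x y = wedge F A (c x) (c y) := rfl

lemma eq_of_intertwines {P Q : Type*} [AddCommGroup P] [Module F P] [AddCommGroup Q] [Module F Q]
    (e : (Fin d → F) ≃ₗ[F] P) {φ χ : P →ₗ[F] Q} (h : ∀ v, φ (e v) = χ (e v)) : φ = χ :=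
  LinearMap.ext fun x => by simpa using h (e.symm x)

lemma not_tensorDecomposable (hirr : ExtIrreducible G 2) : ¬ NatTensorDecomposable F d G := by
  rintro ⟨m, n, hm, hn, e, he⟩
  obtain ⟨a, a', ha⟩ := exists_linearIndependent_pair (F := F) (P := Fin m → F) (by simpa)
  obtain ⟨b, b', hb⟩ := exists_linearIndependent_pair (F := F) (P := Fin n → F) (by simpa)
  obtain ⟨φ, hφ⟩ := Module.Projective.exists_dual_ne_zero F (ha.ne_zero 0)
  obtain ⟨ψ, hψ⟩ := Module.Projective.exists_dual_ne_zero F (hb.ne_zero 0)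
  simp only [Matrix.cons_val_zero] at hφ hψ
  have := hirr.bilin_mem e ((a ⊗ₜ[F] b) ⊗ₜ[F] (a ⊗ₜ[F] b'))
    (wedgeComp (contractR _ φ ∘ₗ (TensorProduct.comm F _ _).toLinearMap)) (fun v => wedge_self _)
    (by simpa [wedgeComp_apply, hφ] using wedge_ne_zero hb)
    (wedgeComp (contractR _ ψ)) (fun v => wedge_self _) ⊥ (by
      intro g hg φ hφ
      obtain ⟨α, β, h⟩ := he g hg
      obtain rfl := eq_of_intertwines e (fun v => (hφ v).symm.trans (h v))
      simp [wedgeComp_apply, wedge_self]) (a ⊗ₜ b) (a' ⊗ₜ b)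
  rw [wedgeComp_apply] at this
  simp [hψ] at this
  exact wedge_ne_zero ha this

end Tensor

/-! ### Tensor squares -/

section Swap

variable {G : Subgroup (GL (Fin d) F)} {m : ℕ}
  {e : (Fin d → F) ≃ₗ[F] ((Fin m → F) ⊗[F] (Fin m → F))}

lemma exists_wedge_eq {P : Type*} [AddCommGroup P] [Module F P] {z : ExteriorAlgebra F P}
    (hz : z ∈ ⋀[F]^2 P) : ∃ t, TensorProduct.lift (wedge F P) t = z := by
  rw [← ExteriorAlgebra.ιMulti_span_fixedDegree] at hz
  have : Submodule.span F (Set.range (ExteriorAlgebra.ιMulti F 2)) ≤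
      LinearMap.range (TensorProduct.lift (wedge F P)) := by
    rw [Submodule.span_le]
    rintro _ ⟨v, rfl⟩
    exact ⟨v 0 ⊗ₜ v 1, by simp [wedge_apply, ExteriorAlgebra.ιMulti_apply]; rfl⟩
  exact this hz

lemma wedge_comp_eq_zero {P Q : Type*} [AddCommGroup P] [Module F P] [AddCommGroup Q] [Module F Q]
    (f : P →ₗ[F] F) (q : Q) (t : P ⊗[F] P) :
    TensorProduct.lift (wedgeComp (f.smulRight q)) t = 0 := by
  induction t using TensorProduct.induction_on with
  | zero => simp
  | tmul x y => simp [wedgeComp_apply, wedge_self]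
  | add x y hx hy => rw [map_add, hx, hy, add_zero]

lemma lift_wedgeComp {P Q : Type*} [AddCommGroup P] [Module F P] [AddCommGroup Q] [Module F Q]
    (c : P →ₗ[F] Q) (t : P ⊗[F] P) : TensorProduct.lift (wedgeComp c) t =
      ExteriorAlgebra.map c (TensorProduct.lift (wedge F P) t) := by
  rw [map_wedge]
  induction t using TensorProduct.induction_on with
  | zero => simp
  | tmul x y => rfl
  | add x y hx hy => simp only [map_add, hx, hy]

lemma lift_wedgeComp_map {P Q R : Type*} [AddCommGroup P] [Module F P] [AddCommGroup Q]
    [Module F Q] [AddCommGroup R] [Module F R] (c : Q →ₗ[F] R) (f : P →ₗ[F] Q) (t : P ⊗[F] P) :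
    TensorProduct.lift (wedgeComp c) (TensorProduct.map f f t) =
      TensorProduct.lift (wedgeComp (c ∘ₗ f)) t := by
  induction t using TensorProduct.induction_on with
  | zero => simp
  | tmul x y => rfl
  | add x y hx hy => simp only [map_add, hx, hy]

lemma lift_wedgeComp_smul {P Q : Type*} [AddCommGroup P] [Module F P] [AddCommGroup Q]
    [Module F Q] (k : F) (c : P →ₗ[F] Q) (t : P ⊗[F] P) :
    TensorProduct.lift (wedgeComp (k • c)) t = (k * k) • TensorProduct.lift (wedgeComp c) t := by
  induction t using TensorProduct.induction_on with
  | zero => simp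
  | tmul x y => simp [wedgeComp_apply, mul_smul]
  | add x y hx hy => simp only [map_add, hx, hy, smul_add]

lemma ext2_left (hirr : ExtIrreducible G 2) (hm : 2 ≤ m)
    (hfs : ∀ g ∈ G, (∃ a b, FactorWitness F e g a b) ∨ (∃ a b, SwapWitness F e g a b))
    (W : Submodule F (ExteriorAlgebra F (Fin m → F))) (hW : W ≤ ⋀[F]^2 (Fin m → F))
    (hinv : ∀ g ∈ G, ∀ a b, FactorWitness F e g a b → ∀ p ∈ W, ExteriorAlgebra.map a p ∈ W) :
    W = ⊥ ∨ W = ⋀[F]^2 (Fin m → F) := by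
  refine or_iff_not_imp_left.2 fun hW0 => le_antisymm hW ?_
  obtain ⟨w, hw, hw0⟩ := Submodule.exists_mem_ne_zero_of_ne_bot hW0
  obtain ⟨t, rfl⟩ := exists_wedge_eq (hW hw)
  have : Nontrivial (Fin m → F) := Function.nontrivial (h := ⟨⟨0, by lia⟩⟩)
  obtain ⟨b, hb⟩ := exists_ne (0 : Fin m → F)
  obtain ⟨ψ, hψ⟩ := Module.Projective.exists_dual_ne_zero F hb
  set j := (TensorProduct.mk F (Fin m → F) (Fin m → F)).flip b with hj
  set c := contractR (Fin m → F) ψ with hc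
  have hcj : c ∘ₗ j = ψ b • LinearMap.id := by
    refine LinearMap.ext fun x => ?_; simp [hc, hj]
  have key := hirr.bilin_mem e (TensorProduct.map j j t) (wedgeComp c) (fun v => wedge_self _)
    (by
      rw [lift_wedgeComp_map, hcj, lift_wedgeComp_smul, lift_wedgeComp]
      simpa [hψ] using hw0)
    (wedgeComp c) (fun v => wedge_self _) W (by
      intro g hg φ hφ
      rw [lift_wedgeComp_map, lift_wedgeComp_map]
      rcases hfs g hg with ⟨α, β, h⟩ | ⟨α, β, h⟩
      · obtain rfl := eq_of_intertwines e (fun v => (hφ v).symm.trans (h v))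
        have : (c ∘ₗ TensorProduct.map α β) ∘ₗ j = ψ (β b) • α := by
          refine LinearMap.ext fun x => ?_; simp [hc, hj]
        rw [this, lift_wedgeComp_smul, lift_wedgeComp]
        exact W.smul_mem _ (hinv g hg α β h _ hw)
      · obtain rfl := eq_of_intertwines e (χ := TensorProduct.map α β ∘ₗ
          (TensorProduct.comm F _ _).toLinearMap) (fun v => (hφ v).symm.trans (h v))
        have : (c ∘ₗ TensorProduct.map α β ∘ₗ (TensorProduct.comm F _ _).toLinearMap) ∘ₗ j =
            (ψ ∘ₗ β).smulRight (α b) := by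
          refine LinearMap.ext fun x => ?_; simp [hc, hj]
        rw [this, wedge_comp_eq_zero]
        exact W.zero_mem)
  intro z hz
  obtain ⟨s, rfl⟩ := exists_wedge_eq hz
  induction s using TensorProduct.induction_on with
  | zero => simp
  | tmul x y =>
    have h := key (x ⊗ₜ b) (y ⊗ₜ b)
    simp only [wedgeComp_apply, hc, contractR_tmul, map_smul, LinearMap.smul_apply] at h
    rwa [W.smul_mem_iff hψ, W.smul_mem_iff hψ] at h
  | add x y hx hy =>
    rw [map_add]
    exact add_mem (hx (wedge_mem _)) (hy (wedge_mem _))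

/-- The linear form of the symmetric algebra attached to a vector. -/
def linPoly (m : ℕ) : (Fin m → F) →ₗ[F] MvPolynomial (Fin m) F :=
  Fintype.linearCombination F MvPolynomial.X

/-- The multiplication `V ⊗ V → Sym² V`. -/
def symMul (m : ℕ) : (Fin m → F) →ₗ[F] (Fin m → F) →ₗ[F] MvPolynomial (Fin m) F :=
  (LinearMap.mul F _).compl₁₂ (linPoly m) (linPoly m)

lemma symMul_apply (x y : Fin m → F) : symMul m x y = linPoly m x * linPoly m y := rfl

lemma range_linPoly : LinearMap.range (linPoly (F := F) m) = symPow F m 1 := by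
  rw [symPow, MvPolynomial.homogeneousSubmodule_one_eq_span_X, linPoly,
    Fintype.range_linearCombination]

lemma range_symMul : LinearMap.range (TensorProduct.lift (symMul (F := F) m)) = symPow F m 2 := by
  rw [symPow, ← MvPolynomial.homogeneousSubmodule_one_pow, pow_two, ← symPow, ← range_linPoly]
  apply le_antisymm
  · rintro _ ⟨t, rfl⟩
    induction t using TensorProduct.induction_on with
    | zero => simp
    | tmul x y => exact Submodule.mul_mem_mul ⟨x, rfl⟩ ⟨y, rfl⟩
    | add x y hx hy => rw [map_add]; exact add_mem hx hy
  · rw [Submodule.mul_le]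
    rintro _ ⟨x, rfl⟩ _ ⟨y, rfl⟩
    exact ⟨x ⊗ₜ y, rfl⟩

lemma matSubst_linPoly (α : (Fin m → F) →ₗ[F] (Fin m → F)) (x : Fin m → F) :
    matSubst (LinearMap.toMatrix' α) (linPoly m x) = linPoly m (α x) := by
  have : (matSubst (LinearMap.toMatrix' α)).toLinearMap ∘ₗ linPoly m = linPoly m ∘ₗ α := by
    ext1 i
    ext1
    simp [matSubst, linPoly, Fintype.linearCombination_apply, LinearMap.toMatrix'_apply,
      MvPolynomial.smul_eq_C_mul, Pi.single_apply]
  exact LinearMap.congr_fun this x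

/-- An alternating map on `V ⊗ V` with values in `Sym² V`. -/
def symForm (f₁ f₂ : (Fin m → F) →ₗ[F] F) : ((Fin m → F) ⊗[F] (Fin m → F)) →ₗ[F]
    ((Fin m → F) ⊗[F] (Fin m → F)) →ₗ[F] MvPolynomial (Fin m) F :=
  (symMul m).compl₁₂ (contractR _ f₁) (contractR _ f₂) -
    (symMul m).compl₁₂ (contractR _ f₂) (contractR _ f₁)

lemma symForm_self (f₁ f₂ : (Fin m → F) →ₗ[F] F) (v) : symForm f₁ f₂ v v = 0 := by
  simp [symForm, symMul_apply, mul_comm]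

lemma symForm_tmul (f₁ f₂ : (Fin m → F) →ₗ[F] F) (x y b b' : Fin m → F) :
    symForm f₁ f₂ (x ⊗ₜ b) (y ⊗ₜ b') = (f₁ b * f₂ b' - f₂ b * f₁ b') • symMul m x y := by
  simp [symForm, sub_smul, smul_smul, mul_comm]

set_option synthInstance.maxHeartbeats 200000 in
lemma sym2_left (hirr : ExtIrreducible G 2) (h2 : (2 : F) ≠ 0) (hm : 2 ≤ m)
    (hfs : ∀ g ∈ G, (∃ a b, FactorWitness F e g a b) ∨ (∃ a b, SwapWitness F e g a b))
    (W : Submodule F (MvPolynomial (Fin m) F)) (hW : W ≤ symPow F m 2)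
    (hinv : ∀ g ∈ G, ∀ a b, FactorWitness F e g a b →
      ∀ p ∈ W, matSubst (LinearMap.toMatrix' a) p ∈ W) :
    W = ⊥ ∨ W = symPow F m 2 := by
  refine or_iff_not_imp_left.2 fun hW0 => le_antisymm hW ?_
  obtain ⟨w, hw, hw0⟩ := Submodule.exists_mem_ne_zero_of_ne_bot hW0
  obtain ⟨t, rfl⟩ := range_symMul.ge (hW hw)
  set i₀ : Fin m := ⟨0, by lia⟩
  set i₁ : Fin m := ⟨1, by lia⟩
  set b : Fin m → F := Pi.single i₀ 1
  set b' : Fin m → F := Pi.single i₁ 1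
  set f₁ : (Fin m → F) →ₗ[F] F := LinearMap.proj i₀
  set f₂ : (Fin m → F) →ₗ[F] F := LinearMap.proj i₁
  have h01 : i₀ ≠ i₁ := by simp [i₀, i₁]
  have hω : f₁ b * f₂ b' - f₂ b * f₁ b' = 1 := by
    simp [f₁, f₂, b, b', h01, h01.symm]
  set T : (Fin m → F) ⊗[F] (Fin m → F) →ₗ[F] _ :=
    TensorProduct.map ((TensorProduct.mk F (Fin m → F) (Fin m → F)).flip b)
      ((TensorProduct.mk F (Fin m → F) (Fin m → F)).flip b') ∘ₗ
      (LinearMap.id + (TensorProduct.comm F _ _).toLinearMap) with hT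
  have hfac (α β : (Fin m → F) →ₗ[F] (Fin m → F)) : TensorProduct.lift (symForm f₁ f₂)
      (TensorProduct.map (TensorProduct.map α β) (TensorProduct.map α β) (T t)) =
      (2 * (f₁ (β b) * f₂ (β b') - f₂ (β b) * f₁ (β b'))) •
        matSubst (LinearMap.toMatrix' α) (TensorProduct.lift (symMul m) t) := by
    clear hw hw0
    induction t using TensorProduct.induction_on with
    | zero => simp
    | tmul x y =>
      simp [hT, symForm_tmul, symMul_apply, matSubst_linPoly, two_mul, add_smul,
        mul_comm (linPoly m (α y))]
    | add x y hx hy => simp only [map_add, hx, hy, smul_add]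
  have hswap (α β : (Fin m → F) →ₗ[F] (Fin m → F)) : TensorProduct.lift (symForm f₁ f₂)
      (TensorProduct.map (TensorProduct.map α β ∘ₗ (TensorProduct.comm F _ _).toLinearMap)
        (TensorProduct.map α β ∘ₗ (TensorProduct.comm F _ _).toLinearMap) (T t)) = 0 := by
    clear hw hw0 hfac
    induction t using TensorProduct.induction_on with
    | zero => simp
    | tmul x y =>
      simp [hT, symForm_tmul, symMul_apply, ← add_smul]
      left
      ring
    | add x y hx hy => simp only [map_add, hx, hy, add_zero]
  have hone : matSubst (LinearMap.toMatrix' (LinearMap.id : (Fin m → F) →ₗ[F] _))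
      (TensorProduct.lift (symMul m) t) = TensorProduct.lift (symMul m) t := by
    simp [matSubst, Pi.single_apply, apply_ite]
  have key := hirr.bilin_mem e (T t) (symForm f₁ f₂) (symForm_self f₁ f₂)
    (by
      have := hfac LinearMap.id LinearMap.id
      simp only [TensorProduct.map_id, LinearMap.id_apply, hω, hone, mul_one] at this
      rw [this]
      exact smul_ne_zero h2 hw0)
    (symForm f₁ f₂) (symForm_self f₁ f₂) W (by
      intro g hg φ hφ
      rcases hfs g hg with ⟨α, β, h⟩ | ⟨α, β, h⟩
      · obtain rfl := eq_of_intertwines e (fun v => (hφ v).symm.trans (h v))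
        rw [hfac]
        exact W.smul_mem _ (hinv g hg α β h _ hw)
      · obtain rfl := eq_of_intertwines e (χ := TensorProduct.map α β ∘ₗ
          (TensorProduct.comm F _ _).toLinearMap) (fun v => (hφ v).symm.trans (h v))
        rw [hswap]
        exact W.zero_mem)
  rw [← range_symMul]
  rintro _ ⟨s, rfl⟩
  induction s using TensorProduct.induction_on with
  | zero => simp
  | tmul x y =>
    have h := key (x ⊗ₜ b) (y ⊗ₜ b')
    rwa [symForm_tmul, hω, one_smul] at h
  | add x y hx hy =>
    rw [map_add]
    exact add_mem hx hy

lemma factorWitness_comm {g : GL (Fin d) F} {a b : (Fin m → F) →ₗ[F] (Fin m → F)}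
    (h : FactorWitness F e g a b) :
    FactorWitness F (e.trans (TensorProduct.comm F _ _)) g b a := by
  intro v
  rw [LinearEquiv.trans_apply, h, ← TensorProduct.map_comm]
  rfl

lemma swapWitness_comm {g : GL (Fin d) F} {a b : (Fin m → F) →ₗ[F] (Fin m → F)}
    (h : SwapWitness F e g a b) :
    SwapWitness F (e.trans (TensorProduct.comm F _ _)) g b a := by
  intro v
  rw [LinearEquiv.trans_apply, h, ← TensorProduct.map_comm]
  rfl

lemma comm_trans_comm : (e.trans (TensorProduct.comm F _ _)).trans (TensorProduct.comm F _ _) = e := by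
  ext v
  simp

lemma exists_witness_comm
    (hfs : ∀ g ∈ G, (∃ a b, FactorWitness F e g a b) ∨ (∃ a b, SwapWitness F e g a b)) :
    ∀ g ∈ G, (∃ a b, FactorWitness F (e.trans (TensorProduct.comm F _ _)) g a b) ∨
      (∃ a b, SwapWitness F (e.trans (TensorProduct.comm F _ _)) g a b) := by
  intro g hg
  rcases hfs g hg with ⟨a, b, h⟩ | ⟨a, b, h⟩
  · exact .inl ⟨b, a, factorWitness_comm h⟩
  · exact .inr ⟨b, a, swapWitness_comm h⟩

lemma map_eq_zero_of_proportional {ι P Q : Type*} [AddCommGroup P] [Module F P]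
    [AddCommGroup Q] [Module F Q] (f : P [⋀^ι]→ₗ[F] Q) {v : ι → P} {i j : ι} (hij : i ≠ j)
    {x : P} {p q : F} (hi : v i = p • x) (hj : v j = q • x) : f v = 0 := by
  refine f.map_linearDependent v fun hl => ?_
  have h := (LinearIndepOn.pair_iff v hij).1 (hl.linearIndepOn _) q (-p)
    (by rw [hi, hj, smul_smul, smul_smul, mul_comm, neg_mul, neg_smul, add_neg_cancel])
  exact hl.ne_zero j (by rw [hj, h.1, zero_smul])

lemma not_ext3 (hm : 3 ≤ m)
    (hfs : ∀ g ∈ G, (∃ a b, FactorWitness F e g a b) ∨ (∃ a b, SwapWitness F e g a b)) :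
    ¬ ExtIrreducible G 3 := by
  intro hirr
  obtain ⟨a, ha⟩ := exists_linearIndependent_of_le_finrank (R := F) (M := Fin m → F) (n := 3) (by simpa)
  obtain ⟨ψ, hψ⟩ := Module.Projective.exists_dual_ne_zero F (ha.ne_zero 0)
  set c := contractR (Fin m → F) ψ ∘ₗ e.toLinearMap with hc
  set x : Fin 3 → Fin d → F := ![e.symm (a 0 ⊗ₜ a 0), e.symm (a 0 ⊗ₜ a 1), e.symm (a 1 ⊗ₜ a 0)]
    with hx
  have hlin : LinearIndependent F x := by
    have h : LinearIndependent F fun p : Fin 3 × Fin 3 => a p.1 ⊗ₜ[F] a p.2 :=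
      ha.tmul_of_isDomain ha
    have h' := (h.comp ![(0, 0), (0, 1), (1, 0)] (by decide)).map' e.symm.toLinearMap
      (LinearMap.ker_eq_bot.2 e.symm.injective)
    have hx' : x = e.symm.toLinearMap ∘ (fun p : Fin 3 × Fin 3 => a p.1 ⊗ₜ[F] a p.2) ∘
        ![(0, 0), (0, 1), (1, 0)] := by
      ext1 i
      fin_cases i <;> rfl
    rw [hx']
    exact h'
  have key := hirr.map_mem (ExteriorAlgebra.ιMulti_range F 3 ⟨x, rfl⟩) (ιMulti_ne_zero hlin)
    (ExteriorAlgebra.map c).toLinearMap ⊥ (by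
      intro g hg
      rw [extSubst, AlgHom.toLinearMap_apply, ExteriorAlgebra.map_apply_ιMulti,
        ExteriorAlgebra.map_apply_ιMulti, Submodule.mem_bot]
      rcases hfs g hg with ⟨α, β, h⟩ | ⟨α, β, h⟩
      · refine map_eq_zero_of_proportional _ (i := 0) (j := 1) (by decide) (x := α (a 0))
          (p := ψ (β (a 0))) (q := ψ (β (a 1))) ?_ ?_ <;>
        simp [hc, hx, h _]
      · refine map_eq_zero_of_proportional _ (i := 0) (j := 2) (by decide) (x := α (a 0))
          (p := ψ (β (a 0))) (q := ψ (β (a 1))) ?_ ?_ <;>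
        simp [hc, hx, h _])
    (ExteriorAlgebra.ιMulti F 3 fun i => e.symm (a i ⊗ₜ a 0))
    (ExteriorAlgebra.ιMulti_range F 3 ⟨_, rfl⟩)
  rw [AlgHom.toLinearMap_apply, ExteriorAlgebra.map_apply_ιMulti, Submodule.mem_bot] at key
  refine ιMulti_ne_zero (ha.units_smul fun _ => Units.mk0 _ hψ) ?_
  convert key using 2
  ext1 i
  simp [hc]

end Swap

/-! ### Tensor induced modules -/

section TensorInduced

variable {G : Subgroup (GL (Fin d) F)}

section

variable {ι U : Type*} [Fintype ι] [AddCommGroup U] [Module F U]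

/-- The product bilinear form on a tensor power. -/
def tprodForm (B : ι → U →ₗ[F] U →ₗ[F] F) : (⨂[F] (_ : ι), U) →ₗ[F] (⨂[F] (_ : ι), U) →ₗ[F] F :=
  (PiTensorProduct.map₂ B).compr₂ (PiTensorProduct.lift (MultilinearMap.mkPiAlgebra F ι F))

lemma tprodForm_tprod (B : ι → U →ₗ[F] U →ₗ[F] F) (x y : ι → U) :
    tprodForm B (PiTensorProduct.tprod F x) (PiTensorProduct.tprod F y) =
      ∏ i, B i (x i) (y i) := by
  simp [tprodForm, PiTensorProduct.map₂_tprod_tprod]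

lemma tprodForm_self (h2 : (2 : F) ≠ 0) {B : ι → U →ₗ[F] U →ₗ[F] F} {s : ι → F}
    (hB : ∀ i x y, B i y x = s i * B i x y) (hs : ∏ i, s i = -1) (v : ⨂[F] (_ : ι), U) :
    tprodForm B v v = 0 := by
  have h : (tprodForm B).flip = -tprodForm B := by
    refine PiTensorProduct.ext (MultilinearMap.ext fun x =>
      PiTensorProduct.ext (MultilinearMap.ext fun y => ?_))
    simp [tprodForm_tprod, hB _ (x _), Finset.prod_mul_distrib, hs]
  have h' := LinearMap.congr_fun₂ h v v
  simp only [LinearMap.flip_apply, LinearMap.neg_apply] at h'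
  have : 2 * tprodForm B v v = 0 := by linear_combination h'
  exact (mul_eq_zero.1 this).resolve_left h2

end

/-- The form on the `i`-th tensor factor, alternating for `i < k` and symmetric otherwise. -/
def factorForm {m n : ℕ} (k : ℕ) (i : Fin m) :
    (Fin (n + 2) → F) →ₗ[F] (Fin (n + 2) → F) →ₗ[F] F :=
  if i.val < k then
    wedgeForm (LinearMap.proj 0) (LinearMap.proj 1)
  else (LinearMap.mul F F).compl₁₂ (LinearMap.proj 0) (LinearMap.proj 0)

lemma factorForm_apply {m n : ℕ} (k : ℕ) (i : Fin m) (x y : Fin (n + 2) → F) :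
    factorForm k i x y = if i.val < k then x 0 * y 1 - x 1 * y 0 else x 0 * y 0 := by
  unfold factorForm
  split_ifs <;> simp [wedgeForm_apply]

lemma factorForm_swap {m n : ℕ} (k : ℕ) (i : Fin m) (x y : Fin (n + 2) → F) :
    factorForm k i y x = (if i.val < k then -1 else 1) * factorForm k i x y := by
  rw [factorForm_apply, factorForm_apply]
  split_ifs <;> ring

lemma not_tensorInduced_of_three_le (hirr : ExtIrreducible G 2) (h2 : (2 : F) ≠ 0) {m f : ℕ}
    (hm : 3 ≤ m) (hf : 2 ≤ f) (e : (Fin d → F) ≃ₗ[F] (⨂[F] (_ : Fin m), (Fin f → F)))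
    (he : ∀ g ∈ G, ∃ (σ : Equiv.Perm (Fin m)) (b : Fin m → ((Fin f → F) →ₗ[F] (Fin f → F))),
        ∀ v : Fin d → F,
          e (((g : GL (Fin d) F) : Matrix (Fin d) (Fin d) F).mulVec v) =
            PiTensorProduct.map b
              ((PiTensorProduct.reindex F (fun _ : Fin m => (Fin f → F)) σ) (e v))) : False := by
  obtain ⟨n, rfl⟩ := Nat.exists_eq_add_of_le' hf
  obtain ⟨l, rfl⟩ := Nat.exists_eq_add_of_le' hm
  have hlt (x : ℕ) : ¬ x + 1 + 1 + 1 < 3 := by lia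
  have hself (k : ℕ) (hk : k = 1 ∨ k = 3) (v : ⨂[F] (_ : Fin (l + 3)), (Fin (n + 2) → F)) :
      tprodForm (factorForm k) v v = 0 := by
    refine tprodForm_self h2 (fun i x y => factorForm_swap k i x y) ?_ v
    rcases hk with rfl | rfl <;> simp [Fin.prod_univ_succ, hlt]
  have key := hirr.bilin_mem e
    (PiTensorProduct.tprod F (fun _ => Pi.single 0 1) ⊗ₜ
      PiTensorProduct.tprod F (Function.update (fun _ => Pi.single 0 1) 0 (Pi.single 1 1)))
    (tprodForm (factorForm 1)) (hself 1 (by simp))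
    (by simp [tprodForm_tprod, factorForm_apply, Fin.prod_univ_succ])
    (tprodForm (factorForm 3)) (hself 3 (by simp)) ⊥ (by
      intro g hg φ hφ
      obtain ⟨σ, b, h⟩ := he g hg
      obtain rfl := eq_of_intertwines e (χ := PiTensorProduct.map b ∘ₗ
        (PiTensorProduct.reindex F (fun _ => (Fin (n + 2) → F)) σ).toLinearMap)
        (fun v => (hφ v).symm.trans (h v))
      obtain ⟨i, hi3, hi⟩ : ∃ i : Fin (l + 3), i.val < 3 ∧ σ.symm i ≠ 0 := by
        by_cases h0 : σ.symm 0 = 0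
        · exact ⟨1, by simp, fun h1 => by simpa using σ.symm.injective (h1.trans h0.symm)⟩
        · exact ⟨0, by simp, h0⟩
      simp only [TensorProduct.map_tmul, TensorProduct.lift.tmul, LinearMap.comp_apply,
        LinearEquiv.coe_coe, PiTensorProduct.reindex_tprod, PiTensorProduct.map_tprod,
        tprodForm_tprod, Submodule.mem_bot]
      refine Finset.prod_eq_zero (Finset.mem_univ i) ?_
      simp [factorForm_apply, hi3, hi, mul_comm])
    (PiTensorProduct.tprod F (fun _ => Pi.single 0 1))
    (PiTensorProduct.tprod F (fun i => if i.val < 3 then Pi.single 1 1 else Pi.single 0 1))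
  simp [tprodForm_tprod, factorForm_apply, Fin.prod_univ_succ, hlt] at key

lemma update_pair_zero {U : Type*} (x y z : U) : Function.update ![x, y] 0 z = ![z, y] := by
  ext i
  fin_cases i <;> rfl

lemma update_pair_one {U : Type*} (x y z : U) : Function.update ![x, y] 1 z = ![x, z] := by
  ext i
  fin_cases i <;> rfl

/-- The tensor power over `Fin 2` is the tensor square. -/
def tensorSquareEquiv (U : Type*) [AddCommGroup U] [Module F U] :
    (⨂[F] (_ : Fin 2), U) ≃ₗ[F] U ⊗[F] U :=
  LinearEquiv.ofLinearMap
    (PiTensorProduct.lift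
      { toFun := fun u => u 0 ⊗ₜ[F] u 1
        map_update_add' := by
          intro inst v i x y
          rw [Subsingleton.elim inst (instDecidableEqFin 2)]
          fin_cases i <;> simp [TensorProduct.add_tmul, TensorProduct.tmul_add]
        map_update_smul' := by
          intro inst v i x y
          rw [Subsingleton.elim inst (instDecidableEqFin 2)]
          fin_cases i <;> simp [TensorProduct.smul_tmul'] })
    (TensorProduct.lift (LinearMap.mk₂ F (fun x y => PiTensorProduct.tprod F ![x, y])
      (fun x x' y => by
        simpa [-MultilinearMap.map_update_add, update_pair_zero, update_pair_one] using
          (PiTensorProduct.tprod F).map_update_add ![x, y] 0 x x')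
      (fun c x y => by
        simpa [-MultilinearMap.map_update_smul, update_pair_zero, update_pair_one] using
          (PiTensorProduct.tprod F).map_update_smul ![x, y] 0 c x)
      (fun x y y' => by
        simpa [-MultilinearMap.map_update_add, update_pair_zero, update_pair_one] using
          (PiTensorProduct.tprod F).map_update_add ![x, y] 1 y y')
      (fun c x y => by
        simpa [-MultilinearMap.map_update_smul, update_pair_zero, update_pair_one] using
          (PiTensorProduct.tprod F).map_update_smul ![x, y] 1 c y)))
    (by ext x y; simp)
    (by
      refine PiTensorProduct.ext (MultilinearMap.ext fun x => ?_)
      simp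
      congr 1
      ext i
      fin_cases i <;> rfl)

lemma tensorSquareEquiv_tprod {U : Type*} [AddCommGroup U] [Module F U] (u : Fin 2 → U) :
    tensorSquareEquiv U (PiTensorProduct.tprod F u) = u 0 ⊗ₜ u 1 := by
  simp [tensorSquareEquiv]

lemma tensorSquareEquiv_map {U : Type*} [AddCommGroup U] [Module F U]
    (b : Fin 2 → U →ₗ[F] U) (σ : Equiv.Perm (Fin 2)) (x : ⨂[F] (_ : Fin 2), U) :
    tensorSquareEquiv U (PiTensorProduct.map b (PiTensorProduct.reindex F (fun _ => U) σ x)) =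
      if σ = 1 then TensorProduct.map (b 0) (b 1) (tensorSquareEquiv U x) else
        TensorProduct.map (b 0) (b 1) (TensorProduct.comm F U U (tensorSquareEquiv U x)) := by
  have hσ : σ = 1 ∨ σ = Equiv.swap 0 1 := by
    revert σ
    decide
  induction x using PiTensorProduct.induction_on with
  | smul_tprod c u =>
    rcases hσ with rfl | rfl <;> simp [tensorSquareEquiv_tprod, PiTensorProduct.reindex_tprod] <;> rfl
  | add x y hx hy => rw [map_add, map_add, map_add, hx, hy]; split_ifs <;> simp

lemma tensorSwapCase_of_induced (hirr : ExtIrreducible G 2) (h2 : (2 : F) ≠ 0)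
    (h : NatTensorInduced F d G) : TensorSwapCase F d G := by
  obtain ⟨k, m, hk, hm, e₀, he⟩ := h
  obtain rfl : k = 2 := by
    by_contra hk2
    exact not_tensorInduced_of_three_le hirr h2 (by lia) hm e₀ he
  set e := e₀.trans (tensorSquareEquiv (Fin m → F)) with hedef
  have hfs : ∀ g ∈ G, (∃ a b, FactorWitness F e g a b) ∨ (∃ a b, SwapWitness F e g a b) := by
    intro g hg
    obtain ⟨σ, b, h⟩ := he g hg
    by_cases hσ : σ = 1
    · exact .inl ⟨b 0, b 1, fun v => by
        rw [hedef, LinearEquiv.trans_apply, h, tensorSquareEquiv_map, if_pos hσ]; rfl⟩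
    · exact .inr ⟨b 0, b 1, fun v => by
        rw [hedef, LinearEquiv.trans_apply, h, tensorSquareEquiv_map, if_neg hσ]; rfl⟩
  have hd : d = m * m := by
    simpa using e.finrank_eq
  have hsym : symPow F m 2 ≠ ⊥ := by
    refine Submodule.ne_bot_iff _ |>.2 ⟨MvPolynomial.X ⟨0, by lia⟩ ^ 2, ?_, by simp⟩
    exact MvPolynomial.isHomogeneous_X_pow _ 2
  have hext : (⋀[F]^2 (Fin m → F)) ≠ ⊥ := by
    obtain ⟨x, y, hxy⟩ := exists_linearIndependent_pair (F := F) (P := Fin m → F) (by simpa)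
    refine Submodule.ne_bot_iff _ |>.2 ⟨_, wedge_mem (x ⊗ₜ y), ?_⟩
    simpa using wedge_ne_zero hxy
  have hfs' := exists_witness_comm hfs
  have hback {g : GL (Fin d) F} {a b} (h : FactorWitness F (e.trans (TensorProduct.comm F _ _)) g a b) :
      FactorWitness F e g b a := by
    have := factorWitness_comm h
    rwa [comm_trans_comm] at this
  refine ⟨m, hm, hd, e, hfs, ?_, ⟨hsym, sym2_left hirr h2 hm hfs⟩, ⟨hsym, fun W hW hinv =>
    sym2_left hirr h2 hm hfs' W hW fun g hg a b h => ?_⟩, ⟨hext, ext2_left hirr hm hfs⟩, ⟨hext,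
    fun W hW hinv => ext2_left hirr hm hfs' W hW fun g hg a b h => ?_⟩,
    fun hd5 => not_ext3 (by nlinarith) hfs⟩
  · by_contra! hno
    refine not_tensorDecomposable hirr ⟨m, m, hm, hm, e, fun g hg => ?_⟩
    rcases hfs g hg with h | ⟨a, b, h⟩
    · exact h
    · exact absurd h (hno g hg a b)
  · exact hinv g hg b a (hback h)
  · exact hinv g hg b a (hback h)

end TensorInduced


/-- **Lemma (Guralnick–Tiep, Lemma `step1a`).**  Let `F` be an algebraically closed field with
`char(F) = 0` or `char(F) > 3`, let `V = F^d` with `d ≥ 3`, and let `G ≤ GL(V)` be a subgroup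
such that `⋀²(V)` is irreducible over `G`.  Then `G` satisfies hypothesis (S), or `V` is a sum
of `d` one-dimensional subspaces on which `G` acts 2-homogeneously, or `V = V₁ ⊗ V₂` with `G`
permuting `V₁, V₂` transitively (with the properties listed in `TensorSwapCase`). -/
theorem ext2_irreducible_trichotomy (F : Type*) [Field F] [IsAlgClosed F] (d : ℕ) (hd : 3 ≤ d)
    (hchar : ringChar F = 0 ∨ 3 < ringChar F) (G : Subgroup (GL (Fin d) F))
    (hirr : ExtIrreducible G 2) :
    HypothesisS F d G ∨ MonomialCase F d G ∨ TensorSwapCase F d G := by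
  have h2 : (2 : F) ≠ 0 := Ring.two_ne_zero (by lia)
  by_cases himp : NatImprimitive F d G
  · exact .inr (.inl (monomialCase_of_imprimitive hirr himp))
  by_cases hind : NatTensorInduced F d G
  · exact .inr (.inr (tensorSwapCase_of_induced hirr h2 hind))
  exact .inl ⟨natIrreducible_of_ext2 hd hirr, himp, not_tensorDecomposable hirr, hind⟩

end GuralnickTiep
end
end
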